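/- arXiv:2212.00750 — 3 statements merged into one kernel-verified Lean document; each statement's English description precedes it below -/
import Mathlib

section
/- Let d,n ≥ 1 and α > 0 with α < 4/(d+n-4) if d+n > 4 (no restriction if d+n ≤ 4). Then there exists C > 0 such that for all u ∈ H²(ℝ^d × 𝕋^n), ‖u‖_{L^{α+2}}^{α+2} ≤ C ‖u‖_{H²}^{α(d+n)/4} ‖u‖_{L²}^{α+2-α(d+n)/4}. -/
noncomputable section

open MeasureTheory Real Filter Set

namespace BNLS

/-- A point of `ℝ^d × 𝕋^n`, the torus being modelled by periodic functions on `ℝ^n`. -/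
abbrev Pt (d n : ℕ) := (Fin d → ℝ) × (Fin n → ℝ)

/-- Fundamental domain `[0,2π)^n` of the torus `(ℝ/2πℤ)^n`. -/
def torusBox (n : ℕ) : Set (Fin n → ℝ) := Set.univ.pi fun _ => Set.Ico 0 (2*π)

/-- The measure of the torus `𝕋^n`. -/
def μT (n : ℕ) : Measure (Fin n → ℝ) := volume.restrict (torusBox n)

/-- The measure of `ℝ^d × 𝕋^n`. -/
def μP (d n : ℕ) : Measure (Pt d n) := (volume : Measure (Fin d → ℝ)).prod (μT n)

/-- Partial derivative in the `i`-th `x`-direction. -/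
def dX (d n : ℕ) (i : Fin d) (u : Pt d n → ℂ) : Pt d n → ℂ :=
  fun p => fderiv ℝ u p (Pi.single i 1, 0)

/-- Partial derivative in the `j`-th `y`-direction. -/
def dY (d n : ℕ) (j : Fin n) (u : Pt d n → ℂ) : Pt d n → ℂ :=
  fun p => fderiv ℝ u p (0, Pi.single j 1)

/-- Partial Laplacian `Δ_x`. -/
def lapX (d n : ℕ) (u : Pt d n → ℂ) : Pt d n → ℂ := fun p => ∑ i, dX d n i (dX d n i u) p

/-- Partial Laplacian `Δ_y`. -/
def lapY (d n : ℕ) (u : Pt d n → ℂ) : Pt d n → ℂ := fun p => ∑ j, dY d n j (dY d n j u) p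

/-- Full Laplacian `Δ_{x,y}`. -/
def lap (d n : ℕ) (u : Pt d n → ℂ) : Pt d n → ℂ := fun p => lapX d n u p + lapY d n u p

/-- Mass `‖u‖_{L²}²`. -/
def Mass (d n : ℕ) (u : Pt d n → ℂ) : ℝ := ∫ z, ‖u z‖^2 ∂(μP d n)

/-- `‖u‖_{L^p}^p`. -/
def Npow (d n : ℕ) (p : ℝ) (u : Pt d n → ℂ) : ℝ := ∫ z, ‖u z‖ ^ p ∂(μP d n)

/-- The `L^p` norm. -/
def LpN (d n : ℕ) (p : ℝ) (u : Pt d n → ℂ) : ℝ := (Npow d n p u) ^ (1/p)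

/-- `‖Δ u‖_{L²}²`. -/
def lapSq (d n : ℕ) (u : Pt d n → ℂ) : ℝ := ∫ z, ‖lap d n u z‖^2 ∂(μP d n)

/-- `‖Δ_x u‖_{L²}²`. -/
def lapXSq (d n : ℕ) (u : Pt d n → ℂ) : ℝ := ∫ z, ‖lapX d n u z‖^2 ∂(μP d n)

/-- `‖Δ_y u‖_{L²}²`. -/
def lapYSq (d n : ℕ) (u : Pt d n → ℂ) : ℝ := ∫ z, ‖lapY d n u z‖^2 ∂(μP d n)

/-- `‖∇_x u‖_{L²}²`. -/
def gradXSq (d n : ℕ) (u : Pt d n → ℂ) : ℝ := ∫ z, (∑ i, ‖dX d n i u z‖^2) ∂(μP d n)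

/-- `‖∇_y u‖_{L²}²`. -/
def gradYSq (d n : ℕ) (u : Pt d n → ℂ) : ℝ := ∫ z, (∑ j, ‖dY d n j u z‖^2) ∂(μP d n)

/-- `‖∇ u‖_{L²}²`. -/
def gradSq (d n : ℕ) (u : Pt d n → ℂ) : ℝ := gradXSq d n u + gradYSq d n u

/-- Pointwise sum of squares of all second derivatives. -/
def hessInt (d n : ℕ) (u : Pt d n → ℂ) (z : Pt d n) : ℝ :=
  (∑ i, ∑ i', ‖dX d n i (dX d n i' u) z‖^2) + (∑ i, ∑ j, ‖dY d n j (dX d n i u) z‖^2)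
  + (∑ j, ∑ i, ‖dX d n i (dY d n j u) z‖^2) + (∑ j, ∑ j', ‖dY d n j (dY d n j' u) z‖^2)

/-- `‖∇² u‖_{L²}²`. -/
def hessSq (d n : ℕ) (u : Pt d n → ℂ) : ℝ := ∫ z, hessInt d n u z ∂(μP d n)

/-- The `H²` norm on `ℝ^d × 𝕋^n`. -/
def H2norm (d n : ℕ) (u : Pt d n → ℂ) : ℝ :=
  Real.sqrt (Mass d n u + gradSq d n u + hessSq d n u)

/-- `2π`-periodicity in all `y`-variables. -/
def Periodic (d n : ℕ) (u : Pt d n → ℂ) : Prop :=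
  ∀ j : Fin n, ∀ p : Pt d n, u (p.1, p.2 + (2*π) • (Pi.single j 1 : Fin n → ℝ)) = u p

/-- Membership in `H²(ℝ^d × 𝕋^n)`. -/
def InH2 (d n : ℕ) (u : Pt d n → ℂ) : Prop :=
  ContDiff ℝ 2 u ∧ Periodic d n u ∧
  Integrable (fun z => ‖u z‖^2) (μP d n) ∧
  Integrable (fun z => (∑ i, ‖dX d n i u z‖^2) + ∑ j, ‖dY d n j u z‖^2) (μP d n) ∧
  Integrable (hessInt d n u) (μP d n)

/-- The mass sphere `S(c)`. -/
def Sset (d n : ℕ) (c : ℝ) : Set (Pt d n → ℂ) := {u | InH2 d n u ∧ Mass d n u = c}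

/-- The energy functional `E`. -/
def En (d n : ℕ) (β α : ℝ) (u : Pt d n → ℂ) : ℝ :=
  (1/2) * lapSq d n u + (β/2) * gradSq d n u - (1/(α+2)) * Npow d n (α+2) u

/-- The ground state energy `m_c`. -/
def mC (d n : ℕ) (β α c : ℝ) : ℝ := sInf (En d n β α '' Sset d n c)

end BNLS

namespace BNLSAux
open BNLS
open scoped ENNReal NNReal

/-- Periodicity in `y` for functions with arbitrary values. -/
def Per {β : Type*} (d n : ℕ) (f : Pt d n → β) : Prop :=
  ∀ j : Fin n, ∀ p : Pt d n, f (p.1, p.2 + (2*π) • (Pi.single j 1 : Fin n → ℝ)) = f p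

instance sfin_T (n : ℕ) : SFinite (μT n) := by unfold μT; infer_instance
instance sfin_P (d n : ℕ) : SFinite (μP d n) := by unfold μP; infer_instance

instance haar_Pt (d n : ℕ) : (volume : Measure (Pt d n)).IsAddHaarMeasure := by
  exact Measure.prod.instIsAddHaarMeasure (volume : Measure (Fin d → ℝ))
    (volume : Measure (Fin n → ℝ))

/-- The lattice basis `2π e_j`. -/
def latB (n : ℕ) : Module.Basis (Fin n) ℝ (Fin n → ℝ) :=
  (Pi.basisFun ℝ (Fin n)).isUnitSMul (fun _ => (IsUnit.mk0 (2*π) (by positivity) : IsUnit (2*π)))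

lemma latB_apply (n : ℕ) (j : Fin n) : latB n j = (2*π) • (Pi.single j 1 : Fin n → ℝ) := by
  simp [latB, Module.Basis.isUnitSMul_apply]

lemma torusBox_eq (n : ℕ) : ZSpan.fundamentalDomain (latB n) = torusBox n := by
  ext m
  have hpi : (0:ℝ) < 2 * π := by positivity
  simp only [ZSpan.mem_fundamentalDomain, latB, Module.Basis.repr_isUnitSMul, Pi.basisFun_repr,
    Units.smul_def, Units.val_inv_eq_inv_val, IsUnit.unit_spec, torusBox, Set.mem_pi, Set.mem_univ,
    true_implies, Set.mem_Ico, smul_eq_mul]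
  refine forall_congr' fun i => ?_
  rw [inv_mul_eq_div, div_lt_one hpi, le_div_iff₀ hpi, zero_mul]

lemma per_lattice {n : ℕ} (g : (Fin n → ℝ) → ℝ≥0∞)
    (hg : ∀ j y, g (y + (2*π) • (Pi.single j 1 : Fin n → ℝ)) = g y)
    (v : Fin n → ℝ) (hv : v ∈ Submodule.span ℤ (Set.range (latB n))) :
    ∀ y, g (v + y) = g y := by
  induction hv using Submodule.span_induction with
  | mem x h =>
    obtain ⟨j, rfl⟩ := h
    intro y
    rw [latB_apply, add_comm, hg]
  | zero => intro y; rw [zero_add]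
  | add x y _ _ hx hy => intro z; rw [add_assoc, hx, hy]
  | smul a x _ hx =>
    have hnat : ∀ k : ℕ, ∀ y, g (((k:ℤ) • x) + y) = g y := by
      intro k
      induction k with
      | zero => intro y; simp
      | succ k ih =>
        intro y
        have : (((k+1 : ℕ):ℤ) • x) + y = x + ((k:ℤ) • x + y) := by
          push_cast; rw [add_smul, one_smul]; abel
        rw [this, hx, ih]
    intro y
    obtain ⟨k, rfl | rfl⟩ := a.eq_nat_or_neg
    · exact hnat k y
    · have := hnat k (-(k:ℤ) • x + y)
      rw [← this]
      congr 1
      simp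

lemma torus_translate {n : ℕ} (g : (Fin n → ℝ) → ℝ≥0∞)
    (hg : ∀ j y, g (y + (2*π) • (Pi.single j 1 : Fin n → ℝ)) = g y) (h : Fin n → ℝ) :
    ∫⁻ y, g (y + h) ∂(μT n) = ∫⁻ y, g y ∂(μT n) := by
  have hf := ZSpan.isAddFundamentalDomain' (latB n) (volume : Measure (Fin n → ℝ))
  rw [torusBox_eq] at hf
  have hf2 := hf.vadd_of_comm h
  have : Countable (Submodule.span ℤ (Set.range (latB n))).toAddSubgroup :=
    inferInstanceAs (Countable (Submodule.span ℤ (Set.range (latB n))))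
  have key := hf2.setLIntegral_eq hf g (by
    rintro ⟨v, hv⟩ x
    exact per_lattice g hg v hv x)
  unfold μT
  rw [← key]
  have mp : MeasurePreserving (fun y : Fin n → ℝ => y + h) volume volume :=
    measurePreserving_add_right volume h
  have := mp.setLIntegral_comp_emb (measurableEmbedding_addRight h) g (torusBox n)
  rw [this]
  congr 2
  ext y
  simp only [Set.mem_image, Set.mem_vadd_set, vadd_eq_add, add_comm h]

lemma translate {d n : ℕ} (f : Pt d n → ℝ≥0∞) (hm : Measurable f) (hf : Per d n f) (h : Pt d n) :
    ∫⁻ z, f (z + h) ∂(μP d n) = ∫⁻ z, f z ∂(μP d n) := by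
  unfold μP
  rw [lintegral_prod _ (by fun_prop), lintegral_prod _ hm.aemeasurable]
  have : ∀ x, ∫⁻ y, f ((x, y) + h) ∂(μT n) = ∫⁻ y, f (x + h.1, y) ∂(μT n) := by
    intro x
    exact torus_translate (fun y => f (x + h.1, y)) (fun j y => hf j (x + h.1, y)) h.2
  simp_rw [this]
  exact lintegral_add_right_eq_self (fun x => ∫⁻ y, f (x, y) ∂(μT n)) h.1

lemma ball_le {d n : ℕ} (f : Pt d n → ℝ≥0∞) (hm : Measurable f) (hf : Per d n f) (z : Pt d n)
    {r : ℝ} (hr : r ≤ 1) :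
    ∫⁻ w in Metric.closedBall z r, f w ≤ ∫⁻ w, f w ∂(μP d n) := by
  set c : Fin n → ℝ := fun j => z.2 j - 1 with hc
  have h1 : ∫⁻ w, f w ∂(μP d n) = ∫⁻ w in (fun w : Pt d n => w + (0, c)) '' (univ ×ˢ torusBox n), f w := by
    rw [← translate f hm hf (0, c)]
    have mp : MeasurePreserving (fun y : Pt d n => y + (0, c)) volume volume :=
      measurePreserving_add_right volume _
    rw [← mp.setLIntegral_comp_emb (measurableEmbedding_addRight _) f]
    congr 1
    unfold μP μT
    rw [← Measure.restrict_univ (μ := (volume : Measure (Fin d → ℝ))), Measure.prod_restrict]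
    simp [Measure.volume_eq_prod]
  rw [h1]
  refine lintegral_mono_set ?_
  intro w hw
  refine ⟨(w.1, w.2 - c), ⟨mem_univ _, ?_⟩, ?_⟩
  · intro j _
    have hpi := Real.pi_gt_three
    have hd : dist w.2 z.2 ≤ 1 := le_trans (le_trans (le_max_right _ _) hw) hr
    have hj : dist (w.2 j) (z.2 j) ≤ 1 := le_trans (dist_le_pi_dist _ _ j) hd
    rw [Real.dist_eq, abs_le] at hj
    simp only [hc, Pi.sub_apply, Set.mem_Ico]
    constructor <;> linarith
  · ext i <;> simp

lemma jensen {α : Type*} [MeasurableSpace α] (ν : Measure α) [IsProbabilityMeasure ν]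
    {q : ℝ} (hq : 1 < q) (f : α → ℝ≥0∞) (hf : AEMeasurable f ν) :
    (∫⁻ a, f a ∂ν) ^ q ≤ ∫⁻ a, f a ^ q ∂ν := by
  have := ENNReal.lintegral_mul_le_Lp_mul_Lq ν (Real.HolderConjugate.conjExponent hq) hf
    (aemeasurable_const (b := (1:ℝ≥0∞)))
  simp only [Pi.mul_apply, mul_one, ENNReal.one_rpow, lintegral_const, measure_univ] at this
  have h2 := ENNReal.rpow_le_rpow this (by linarith : 0 ≤ q)
  rwa [← ENNReal.rpow_mul, one_div, inv_mul_cancel₀ (by linarith), ENNReal.rpow_one] at h2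

lemma jensen2 {α : Type*} [MeasurableSpace α] (ν : Measure α) [IsProbabilityMeasure ν]
    (f : α → ℝ≥0∞) (hf : AEMeasurable f ν) :
    (∫⁻ a, f a ∂ν) ^ 2 ≤ ∫⁻ a, f a ^ 2 ∂ν := by
  have := jensen ν (q := 2) (by norm_num) f hf
  simpa using this

lemma diff1 {d n : ℕ} (v : Pt d n → ℂ) (hv : ContDiff ℝ 1 v) (hp : Per d n v) (h : Pt d n) :
    ∫⁻ z, ‖v (z + h) - v z‖ₑ ^ 2 ∂(μP d n) ≤ ∫⁻ z, ‖fderiv ℝ v z h‖ₑ ^ 2 ∂(μP d n) := by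
  have hcd : Continuous (fun z => fderiv ℝ v z h) :=
    (hv.continuous_fderiv (by norm_num)).clm_apply continuous_const
  have hpd : Per d n (fun z => fderiv ℝ v z h) := by
    intro j p
    have : (fun z : Pt d n => v (z + (0, (2*π) • (Pi.single j 1 : Fin n → ℝ)))) = v := by
      funext z
      have := hp j z
      rw [← this]
      congr 1
      ext i <;> simp
    have h2 := fderiv_comp_add_right (𝕜 := ℝ) (f := v) (x := p) ((0, (2*π) • (Pi.single j 1 : Fin n → ℝ)) : Pt d n)
    rw [this] at h2
    show fderiv ℝ v _ h = fderiv ℝ v p h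
    rw [h2]
    congr 2
    ext i <;> simp
  have : IsProbabilityMeasure ((volume : Measure ℝ).restrict (Ioc 0 1)) := ⟨by simp⟩
  have pt : ∀ z, ‖v (z + h) - v z‖ₑ ^ 2 ≤
      ∫⁻ t in Ioc (0:ℝ) 1, ‖fderiv ℝ v (z + t • h) h‖ₑ ^ 2 := by
    intro z
    have e : v (z + h) - v z = ∫ t in (0:ℝ)..1, fderiv ℝ v (z + t • h) h := by
      rw [intervalIntegral.integral_eq_sub_of_hasDerivAt (f := fun t : ℝ => v (z + t • h))]
      · simp
      · intro t _
        have h1 : HasDerivAt (fun t : ℝ => z + t • h) h t := by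
          simpa using ((hasDerivAt_id t).smul_const h).const_add z
        exact ((hv.differentiable (by norm_num)) (z + t • h)).hasFDerivAt.comp_hasDerivAt t h1
      · apply Continuous.intervalIntegrable
        exact hcd.comp (by fun_prop : Continuous fun t : ℝ => z + t • h)
    rw [e, intervalIntegral.integral_of_le zero_le_one]
    refine le_trans (pow_le_pow_left' (enorm_integral_le_lintegral_enorm _) 2) ?_
    apply jensen2
    exact (hcd.comp (by fun_prop : Continuous fun t : ℝ => z + t • h)).enorm.measurable.aemeasurable
  refine (lintegral_mono pt).trans ?_
  rw [lintegral_lintegral_swap]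
  · have : ∀ t : ℝ, ∫⁻ z, ‖fderiv ℝ v (z + t • h) h‖ₑ ^ 2 ∂(μP d n)
        = ∫⁻ z, ‖fderiv ℝ v z h‖ₑ ^ 2 ∂(μP d n) := by
      intro t
      refine translate (fun z => ‖fderiv ℝ v z h‖ₑ ^ 2) (by exact hcd.enorm.measurable.pow_const 2) ?_ (t • h)
      intro j p
      have := hpd j p
      simp only at this ⊢
      rw [this]
    simp_rw [this]
    simp
  · apply Measurable.aemeasurable
    have : Continuous (fun p : Pt d n × ℝ => fderiv ℝ v (p.1 + p.2 • h) h) :=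
      hcd.comp (by fun_prop : Continuous fun p : Pt d n × ℝ => p.1 + p.2 • h)
    exact this.enorm.measurable.pow_const 2

lemma clm_bound {d n : ℕ} (L : Pt d n →L[ℝ] ℂ) (h : Pt d n) :
    ‖L h‖ ^ 2 ≤ ‖h‖ ^ 2 * ((d:ℝ) + n) *
      ((∑ i, ‖L (Pi.single i 1, 0)‖ ^ 2) + ∑ j, ‖L (0, Pi.single j 1)‖ ^ 2) := by
  have e : h = (∑ i, h.1 i • ((Pi.single i 1, 0) : Pt d n)) +
      ∑ j, h.2 j • ((0, Pi.single j 1) : Pt d n) := by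
    ext k
    · simp [Prod.fst_sum, Finset.sum_apply, Pi.single_apply]
    · simp [Prod.snd_sum, Finset.sum_apply, Pi.single_apply]
  set a : Fin d ⊕ Fin n → ℝ :=
    Sum.elim (fun i => ‖L (Pi.single i 1, 0)‖) (fun j => ‖L (0, Pi.single j 1)‖) with ha
  have h1 : ‖L h‖ ≤ ‖h‖ * ∑ k, a k := by
    conv_lhs => rw [e]
    rw [map_add, map_sum, map_sum]
    simp only [map_smul, ha, Fintype.sum_sum_type, Sum.elim_inl, Sum.elim_inr, mul_add,
      Finset.mul_sum]
    refine (norm_add_le _ _).trans (add_le_add ?_ ?_)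
    · refine norm_sum_le_of_le _ fun i _ => ?_
      rw [norm_smul]
      gcongr
      exact (norm_le_pi_norm h.1 i).trans (norm_fst_le h)
    · refine norm_sum_le_of_le _ fun i _ => ?_
      rw [norm_smul]
      gcongr
      exact (norm_le_pi_norm h.2 i).trans (norm_snd_le h)
  have h2 := sq_sum_le_card_mul_sum_sq (s := Finset.univ) (f := a)
  calc ‖L h‖ ^ 2 ≤ (‖h‖ * ∑ k, a k) ^ 2 := by gcongr
    _ = ‖h‖ ^ 2 * (∑ k, a k) ^ 2 := by ring
    _ ≤ ‖h‖ ^ 2 * (((d:ℝ) + n) * ∑ k, a k ^ 2) := by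
        gcongr
        simpa using h2
    _ = _ := by
        simp only [ha, Fintype.sum_sum_type, Sum.elim_inl, Sum.elim_inr]; ring

lemma hess_bound {d n : ℕ} (u : Pt d n → ℂ) (hu : ContDiff ℝ 2 u) (h z : Pt d n) :
    ‖fderiv ℝ (fun w => fderiv ℝ u w h) z h‖ ^ 2 ≤
      ‖h‖ ^ 4 * ((d:ℝ) + n) ^ 2 * hessInt d n u z := by
  have hd : DifferentiableAt ℝ (fderiv ℝ u) z :=
    ((hu.fderiv_right (m := 1) (by norm_num)).differentiable (by norm_num)) z
  have key : ∀ k l : Pt d n, fderiv ℝ (fun w => fderiv ℝ u w l) z k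
      = (fderiv ℝ (fderiv ℝ u) z k) l := by
    intro k l
    rw [fderiv_clm_apply hd (differentiableAt_const l)]
    simp
  rw [key]
  have b1 := clm_bound (fderiv ℝ (fderiv ℝ u) z h) h
  simp_rw [← key] at b1
  rw [← key]
  have b2 : ∀ i, ‖fderiv ℝ (fun w => fderiv ℝ u w (Pi.single i 1, 0)) z h‖ ^ 2 ≤
      ‖h‖ ^ 2 * ((d:ℝ) + n) * ((∑ i', ‖dX d n i' (dX d n i u) z‖ ^ 2)
        + ∑ j, ‖dY d n j (dX d n i u) z‖ ^ 2) :=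
    fun i => clm_bound (fderiv ℝ (dX d n i u) z) h
  have b3 : ∀ j, ‖fderiv ℝ (fun w => fderiv ℝ u w (0, Pi.single j 1)) z h‖ ^ 2 ≤
      ‖h‖ ^ 2 * ((d:ℝ) + n) * ((∑ i', ‖dX d n i' (dY d n j u) z‖ ^ 2)
        + ∑ j', ‖dY d n j' (dY d n j u) z‖ ^ 2) :=
    fun j => clm_bound (fderiv ℝ (dY d n j u) z) h
  refine b1.trans ((mul_le_mul_of_nonneg_left
    (add_le_add (Finset.sum_le_sum fun i _ => b2 i) (Finset.sum_le_sum fun j _ => b3 j))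
    (by positivity)).trans (le_of_eq ?_))
  rw [← Finset.mul_sum, ← Finset.mul_sum, Finset.sum_add_distrib, Finset.sum_add_distrib]
  unfold hessInt
  rw [Finset.sum_comm (f := fun i i' => ‖dX d n i (dX d n i' u) z‖ ^ 2),
    Finset.sum_comm (f := fun j j' => ‖dY d n j (dY d n j' u) z‖ ^ 2)]
  ring

lemma per_fderiv {d n : ℕ} (v : Pt d n → ℂ) (hp : Per d n v) (h : Pt d n) :
    Per d n (fun z => fderiv ℝ v z h) := by
  intro j p
  have : (fun z : Pt d n => v (z + (0, (2*π) • (Pi.single j 1 : Fin n → ℝ)))) = v := by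
    funext z
    have := hp j z
    rw [← this]
    congr 1
    ext i <;> simp
  have h2 := fderiv_comp_add_right (𝕜 := ℝ) (f := v) (x := p)
    ((0, (2*π) • (Pi.single j 1 : Fin n → ℝ)) : Pt d n)
  rw [this] at h2
  show fderiv ℝ v _ h = fderiv ℝ v p h
  rw [h2]
  congr 2
  ext i <;> simp

lemma per_shift {β : Type*} {d n : ℕ} (f : Pt d n → β) (hp : Per d n f) (h : Pt d n) :
    Per d n (fun z => f (z + h)) := by
  intro j p
  have := hp j (p + h)
  simp only at this ⊢
  rw [← this]
  congr 1
  ext i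
  · simp
  · simp; ring

lemma diff2 {d n : ℕ} (u : Pt d n → ℂ) (hu : ContDiff ℝ 2 u) (hp : Per d n u) (h : Pt d n) :
    ∫⁻ z, ‖u (z + h) + u (z - h) - 2 * u z‖ₑ ^ 2 ∂(μP d n) ≤
      ENNReal.ofReal (‖h‖ ^ 4 * ((d:ℝ) + n) ^ 2) *
        ∫⁻ z, ENNReal.ofReal (hessInt d n u z) ∂(μP d n) := by
  set W : Pt d n → ℂ := fun z => u (z + h) - u z with hW
  have hWc : ContDiff ℝ 2 W := (hu.comp (contDiff_id.add contDiff_const)).sub hu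
  have hWp : Per d n W := by
    intro j p
    have h1 := per_shift u hp h j p
    have h2 := hp j p
    simp only [hW] at h1 h2 ⊢
    rw [h1, h2]
  have s1 : ∫⁻ z, ‖u (z + h) + u (z - h) - 2 * u z‖ₑ ^ 2 ∂(μP d n)
      = ∫⁻ z, ‖W (z + h) - W z‖ₑ ^ 2 ∂(μP d n) := by
    rw [← translate (fun z => ‖u (z + h) + u (z - h) - 2 * u z‖ₑ ^ 2) _ _ h]
    · refine lintegral_congr fun z => ?_
      simp only [hW, add_sub_cancel_right]
      congr 2
      ring
    · have := hu.continuous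
      have c : Continuous (fun z => u (z + h) + u (z - h) - 2 * u z) := by fun_prop
      exact c.enorm.measurable.pow_const 2
    · intro j p
      have h1 := per_shift u hp h j p
      have h2 := hp j p
      have h3 := per_shift u hp (-h) j p
      simp only [← sub_eq_add_neg] at h1 h2 h3 ⊢
      rw [h1, h2, h3]
  rw [s1]
  refine (diff1 W (hWc.of_le (by norm_num)) hWp h).trans ?_
  have hvc : ContDiff ℝ 1 (fun z => fderiv ℝ u z h) :=
    (hu.fderiv_right (m := 1) (by norm_num)).clm_apply contDiff_const
  have s2 : ∀ z, fderiv ℝ W z h = fderiv ℝ u (z + h) h - fderiv ℝ u z h := by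
    intro z
    have hdu := hu.differentiable (by norm_num)
    simp only [hW]
    rw [fderiv_fun_sub _ (hdu z), fderiv_comp_add_right]
    · simp
    · exact (hdu _).comp z (by fun_prop)
  simp_rw [s2]
  refine (diff1 (fun z => fderiv ℝ u z h) hvc (per_fderiv u hp h) h).trans ?_
  rw [← lintegral_const_mul' _ _ ENNReal.ofReal_ne_top]
  refine lintegral_mono fun z => ?_
  rw [← ENNReal.ofReal_mul (by positivity), ← ofReal_norm, ← ENNReal.ofReal_pow (norm_nonneg _)]
  exact ENNReal.ofReal_le_ofReal (hess_bound u hu h z)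

/-- Uniform probability measure on the cube of half-side `r`. -/
def nu (d n : ℕ) (r : ℝ) : Measure (Pt d n) :=
  (volume (Metric.closedBall (0 : Pt d n) r))⁻¹ • volume.restrict (Metric.closedBall 0 r)

lemma vol_ball (d n : ℕ) (z : Pt d n) {r : ℝ} (hr : 0 ≤ r) :
    volume (Metric.closedBall z r) = ENNReal.ofReal ((2 * r) ^ (d + n)) := by
  rw [← Prod.mk.eta (p := z), ← closedBall_prod_same, Measure.volume_eq_prod, Measure.prod_prod,
    Real.volume_pi_closedBall _ hr, Real.volume_pi_closedBall _ hr,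
    ← ENNReal.ofReal_mul (by positivity), pow_add]
  simp

lemma nu_prob (d n : ℕ) {r : ℝ} (hr : 0 < r) : IsProbabilityMeasure (nu d n r) := by
  constructor
  unfold nu
  rw [Measure.smul_apply, Measure.restrict_apply_univ, smul_eq_mul, ENNReal.inv_mul_cancel]
  · rw [vol_ball _ _ _ hr.le]
    simp; positivity
  · rw [vol_ball _ _ _ hr.le]
    simp

instance nu_sfin (d n : ℕ) (r : ℝ) : SFinite (nu d n r) := by unfold nu; infer_instance

lemma mean_add {d n : ℕ} (f : Pt d n → ℝ≥0∞) (hm : Measurable f) (hf : Per d n f) (z : Pt d n)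
    {r : ℝ} (hr : r ≤ 1) :
    ∫⁻ h, f (z + h) ∂(nu d n r) ≤
      (volume (Metric.closedBall (0 : Pt d n) r))⁻¹ * ∫⁻ w, f w ∂(μP d n) := by
  unfold nu
  rw [lintegral_smul_measure, smul_eq_mul]
  refine mul_le_mul' le_rfl ?_
  refine le_trans (le_of_eq ?_) (ball_le f hm hf z hr)
  have mp : MeasurePreserving (fun y : Pt d n => z + y) volume volume :=
    measurePreserving_add_left volume _
  rw [← mp.setLIntegral_comp_preimage_emb (measurableEmbedding_addLeft _) f]
  congr 2
  ext y
  simp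

lemma mean_sub {d n : ℕ} (f : Pt d n → ℝ≥0∞) (hm : Measurable f) (hf : Per d n f) (z : Pt d n)
    {r : ℝ} (hr : r ≤ 1) :
    ∫⁻ h, f (z - h) ∂(nu d n r) ≤
      (volume (Metric.closedBall (0 : Pt d n) r))⁻¹ * ∫⁻ w, f w ∂(μP d n) := by
  unfold nu
  rw [lintegral_smul_measure, smul_eq_mul]
  refine mul_le_mul' le_rfl ?_
  refine le_trans (le_of_eq ?_) (ball_le f hm hf z hr)
  have mp : MeasurePreserving (fun y : Pt d n => z - y) volume volume :=
    by
    have : (volume : Measure (Pt d n)).IsNegInvariant :=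
      ⟨((Measure.measurePreserving_neg (volume : Measure (Fin d → ℝ))).prod
        (Measure.measurePreserving_neg (volume : Measure (Fin n → ℝ)))).map_eq⟩
    exact Measure.measurePreserving_sub_left volume z
  rw [← mp.setLIntegral_comp_preimage_emb (MeasurableEquiv.subLeft z).measurableEmbedding f]
  congr 2
  ext y
  simp

/-- Averaged second difference. -/
def G {d n : ℕ} (u : Pt d n → ℂ) (r : ℝ) (z : Pt d n) : ℝ≥0∞ :=
  ∫⁻ h, ‖u (z + h) + u (z - h) - 2 * u z‖ₑ ∂(nu d n r)

lemma G_meas {d n : ℕ} (u : Pt d n → ℂ) (hu : Continuous u) (r : ℝ) : Measurable (G u r) := by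
  unfold G
  apply Measurable.lintegral_prod_right
  have c : Continuous (fun p : Pt d n × Pt d n => u (p.1 + p.2) + u (p.1 - p.2) - 2 * u p.1) := by
    fun_prop
  exact c.enorm.measurable

lemma G_bound {d n : ℕ} (u : Pt d n → ℂ) (hu : ContDiff ℝ 2 u) (hp : Per d n u) {r : ℝ}
    (hr : 0 < r) :
    ∫⁻ z, G u r z ^ 2 ∂(μP d n) ≤ ENNReal.ofReal (r ^ 4 * ((d:ℝ) + n) ^ 2) *
        ∫⁻ z, ENNReal.ofReal (hessInt d n u z) ∂(μP d n) := by
  have := nu_prob d n hr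
  have hc := hu.continuous
  have c : Continuous (fun p : Pt d n × Pt d n => u (p.1 + p.2) + u (p.1 - p.2) - 2 * u p.1) := by
    fun_prop
  calc ∫⁻ z, G u r z ^ 2 ∂(μP d n) ≤
      ∫⁻ z, ∫⁻ h, ‖u (z + h) + u (z - h) - 2 * u z‖ₑ ^ 2 ∂(nu d n r) ∂(μP d n) := by
        refine lintegral_mono fun z => ?_
        apply jensen2
        exact (c.comp (by fun_prop : Continuous fun h : Pt d n => (z, h))).enorm.measurable.aemeasurable
    _ = ∫⁻ h, ∫⁻ z, ‖u (z + h) + u (z - h) - 2 * u z‖ₑ ^ 2 ∂(μP d n) ∂(nu d n r) := by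
        rw [lintegral_lintegral_swap]
        exact (c.enorm.measurable.pow_const 2).aemeasurable
    _ ≤ ∫⁻ h, ENNReal.ofReal (r ^ 4 * ((d:ℝ) + n) ^ 2) *
        (∫⁻ z, ENNReal.ofReal (hessInt d n u z) ∂(μP d n)) ∂(nu d n r) := by
        apply lintegral_mono_ae
        have : ∀ᵐ h ∂(nu d n r), h ∈ Metric.closedBall (0 : Pt d n) r := by
          unfold nu
          apply Measure.ae_smul_measure
          exact ae_restrict_mem measurableSet_closedBall
        filter_upwards [this] with h hh
        refine (diff2 u hu hp h).trans ?_
        have : ‖h‖ ≤ r := by simpa using hh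
        gcongr
    _ = _ := by simp

lemma split {d n : ℕ} (u : Pt d n → ℂ) (hu : Continuous u) {r : ℝ} (hr : 0 < r) (z : Pt d n) :
    ‖u z‖ₑ ≤ G u r z + (∫⁻ h, ‖u (z + h)‖ₑ ∂(nu d n r) + ∫⁻ h, ‖u (z - h)‖ₑ ∂(nu d n r)) := by
  have := nu_prob d n hr
  unfold G
  have c1 : Continuous fun h => u (z + h) := by fun_prop
  have c2 : Continuous fun h => u (z - h) := by fun_prop
  have c3 : Continuous fun h => u (z + h) + u (z - h) - 2 * u z := by fun_prop
  rw [← lintegral_add_left c1.enorm.measurable, ← lintegral_add_left c3.enorm.measurable]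
  calc ‖u z‖ₑ = ∫⁻ h, ‖u z‖ₑ ∂(nu d n r) := by simp
    _ ≤ _ := by
      refine lintegral_mono fun h => ?_
      simp only [← ofReal_norm]
      rw [← ENNReal.ofReal_add (norm_nonneg _) (norm_nonneg _),
        ← ENNReal.ofReal_add (norm_nonneg _) (by positivity)]
      apply ENNReal.ofReal_le_ofReal
      have e : 2 * u z = (u (z + h) + u (z - h)) - (u (z + h) + u (z - h) - 2 * u z) := by ring
      have h1 : 2 * ‖u z‖ = ‖2 * u z‖ := by simp
      have h2 := norm_sub_le (u (z + h) + u (z - h)) (u (z + h) + u (z - h) - 2 * u z)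
      rw [← e, ← h1] at h2
      have h3 := norm_add_le (u (z + h)) (u (z - h))
      have h4 := norm_nonneg (u z)
      linarith

lemma interp {Ω : Type*} [MeasurableSpace Ω] (μ : Measure Ω) (f : Ω → ℝ≥0∞) (hf : Measurable f)
    (hft : ∀ x, f x ≠ ∞) (g : ℕ → Ω → ℝ≥0∞) (hg : ∀ k, Measurable (g k)) (m : ℕ → ℝ≥0∞)
    (hm : ∀ x : ℝ≥0∞, x ≠ ∞ → ∃ k, x ≤ 2 * m k) (hfg : ∀ k x, f x ≤ g k x + m k)
    {p : ℝ} (hp : 2 ≤ p) :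
    ∫⁻ x, f x ^ p ∂μ ≤ (2 * m 0) ^ (p - 2) * ∫⁻ x, f x ^ 2 ∂μ
      + ∑' k, (2 * m (k + 1)) ^ (p - 2) * (4 * ∫⁻ x, g k x ^ 2 ∂μ) := by
  have pt : ∀ x, f x ^ p ≤ (2 * m 0) ^ (p - 2) * f x ^ 2
      + ∑' k, (2 * m (k + 1)) ^ (p - 2) * (4 * g k x ^ 2) := by
    intro x
    have e : f x ^ p = f x ^ (p - 2) * f x ^ 2 := by
      rw [← ENNReal.rpow_two, ← ENNReal.rpow_add_of_nonneg _ _ (by linarith) (by norm_num)]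
      congr 1; ring
    rw [e]
    classical
    have hex := hm (f x) (hft x)
    rcases hK : Nat.find hex with _ | k
    · have h0 := Nat.find_spec hex
      rw [hK] at h0
      refine le_trans ?_ le_self_add
      exact mul_le_mul' (ENNReal.rpow_le_rpow h0 (by linarith)) le_rfl
    · have h0 := Nat.find_spec hex
      rw [hK] at h0
      have h1 : ¬ f x ≤ 2 * m k := Nat.find_min hex (by omega)
      push Not at h1
      have h2 : f x ≤ 2 * g k x := by
        have h3 : f x + f x ≤ 2 * g k x + f x := by
          calc f x + f x ≤ (g k x + m k) + (g k x + m k) := add_le_add (hfg k x) (hfg k x)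
            _ = 2 * g k x + 2 * m k := by ring
            _ ≤ _ := add_le_add le_rfl h1.le
        exact (ENNReal.add_le_add_iff_right (hft x)).1 h3
      refine le_trans ?_ le_add_self
      refine le_trans ?_ (ENNReal.le_tsum k)
      refine mul_le_mul' (ENNReal.rpow_le_rpow h0 (by linarith)) ?_
      calc f x ^ 2 ≤ (2 * g k x) ^ 2 := pow_le_pow_left' h2 2
        _ = 4 * g k x ^ 2 := by rw [mul_pow]; norm_num
  refine (lintegral_mono pt).trans (le_of_eq ?_)
  rw [lintegral_add_left ((hf.pow_const 2).const_mul _), lintegral_const_mul _ (hf.pow_const 2),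
    lintegral_tsum fun k => (((hg k).pow_const 2).const_mul _ |>.const_mul _).aemeasurable]
  congr 2
  funext k
  rw [lintegral_const_mul _ (((hg k).pow_const 2).const_mul _),
    lintegral_const_mul _ ((hg k).pow_const 2)]

/-- The natural amplitude scale. -/
def Yf (d n : ℕ) (u : Pt d n → ℂ) : ℝ :=
  √(Mass d n u) * (H2norm d n u / √(Mass d n u)) ^ (((d:ℝ) + n) / 4)

/-- The Gagliardo–Nirenberg bound for the exponent `q`. -/
def GN (d n : ℕ) (q : ℝ) : Prop := ∃ C > (0:ℝ), ∀ u : Pt d n → ℂ, InH2 d n u →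
  0 < √(Mass d n u) →
  ∫⁻ z, ‖u z‖ₑ ^ q ∂(μP d n) ≤ ENNReal.ofReal (C * Yf d n u ^ (q - 2) * √(Mass d n u) ^ 2)

lemma mass_nonneg (d n : ℕ) (u : Pt d n → ℂ) : 0 ≤ Mass d n u :=
  integral_nonneg fun _ => by positivity

lemma hessInt_nonneg (d n : ℕ) (u : Pt d n → ℂ) (z : Pt d n) : 0 ≤ hessInt d n u z := by
  unfold hessInt; positivity

lemma gradSq_nonneg (d n : ℕ) (u : Pt d n → ℂ) : 0 ≤ gradSq d n u :=
  add_nonneg (integral_nonneg fun _ => by positivity) (integral_nonneg fun _ => by positivity)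

lemma hessSq_nonneg (d n : ℕ) (u : Pt d n → ℂ) : 0 ≤ hessSq d n u :=
  integral_nonneg fun z => hessInt_nonneg d n u z

lemma mass_le (d n : ℕ) (u : Pt d n → ℂ) : √(Mass d n u) ≤ H2norm d n u := by
  unfold H2norm
  apply Real.sqrt_le_sqrt
  linarith [gradSq_nonneg d n u, hessSq_nonneg d n u]

lemma mass_lint {d n : ℕ} {u : Pt d n → ℂ} (hu : InH2 d n u) :
    ∫⁻ z, ‖u z‖ₑ ^ 2 ∂(μP d n) = ENNReal.ofReal (√(Mass d n u) ^ 2) := by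
  rw [Real.sq_sqrt (mass_nonneg d n u)]
  unfold Mass
  rw [ofReal_integral_eq_lintegral_ofReal hu.2.2.1 (Eventually.of_forall fun _ => by positivity)]
  refine lintegral_congr fun z => ?_
  rw [ENNReal.ofReal_pow (norm_nonneg _), ofReal_norm]

lemma hess_lint {d n : ℕ} {u : Pt d n → ℂ} (hu : InH2 d n u) :
    ∫⁻ z, ENNReal.ofReal (hessInt d n u z) ∂(μP d n) ≤ ENNReal.ofReal (H2norm d n u ^ 2) := by
  rw [← ofReal_integral_eq_lintegral_ofReal hu.2.2.2.2
    (Eventually.of_forall fun z => hessInt_nonneg d n u z)]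
  apply ENNReal.ofReal_le_ofReal
  unfold H2norm
  have h1 := gradSq_nonneg d n u
  have h2 := hessSq_nonneg d n u
  have h3 := mass_nonneg d n u
  rw [Real.sq_sqrt (by linarith)]
  unfold hessSq at *
  linarith

lemma mean_bound {d n : ℕ} {q C : ℝ} (hq : 2 ≤ q) (hC : 0 < C) (u : Pt d n → ℂ)
    (hu : InH2 d n u) {L Y ρ : ℝ} (hY : 0 < Y) (hρ : 0 < ρ) (hρ1 : ρ ≤ 1)
    (hYL : Y ^ 2 * ρ ^ (d + n) = L ^ 2)
    (hI : ∫⁻ z, ‖u z‖ₑ ^ q ∂(μP d n) ≤ ENNReal.ofReal (C * Y ^ (q - 2) * L ^ 2)) (k : ℕ)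
    (z : Pt d n) :
    ‖u z‖ₑ ≤ G u (ρ / 2 ^ k) z +
      ENNReal.ofReal (2 * (C ^ (1 / q) * ((2:ℝ) ^ (((d:ℝ) + n) / q)) ^ k * Y)) := by
  have hr : 0 < ρ / 2 ^ k := by positivity
  have hr1 : ρ / 2 ^ k ≤ 1 := (div_le_self hρ.le (one_le_pow₀ (by norm_num))).trans hρ1
  have := nu_prob d n hr
  have hc := hu.1.continuous
  set m : ℝ := C ^ (1 / q) * ((2:ℝ) ^ (((d:ℝ) + n) / q)) ^ k * Y with hm
  have hm0 : 0 ≤ m := by positivity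
  have hmq : m ^ q = C * (2 ^ (d + n)) ^ k * Y ^ q := by
    rw [hm, Real.mul_rpow (by positivity) hY.le, Real.mul_rpow (by positivity) (by positivity),
      ← Real.rpow_mul hC.le, ← Real.rpow_natCast, ← Real.rpow_mul (by positivity),
      ← Real.rpow_mul (by positivity), one_div, inv_mul_cancel₀ (by linarith), Real.rpow_one,
      ← Real.rpow_natCast, ← Real.rpow_natCast, ← Real.rpow_mul (by positivity)]
    congr 3
    push_cast
    field_simp
  have hB : (volume (Metric.closedBall (0 : Pt d n) (ρ / 2 ^ k)))⁻¹ *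
      ∫⁻ z, ‖u z‖ₑ ^ q ∂(μP d n) ≤ ENNReal.ofReal m ^ q := by
    rw [vol_ball _ _ _ hr.le, ← ENNReal.ofReal_inv_of_pos (by positivity),
      ENNReal.ofReal_rpow_of_nonneg hm0 (by linarith)]
    refine (mul_le_mul' le_rfl hI).trans ?_
    rw [← ENNReal.ofReal_mul (by positivity)]
    apply ENNReal.ofReal_le_ofReal
    rw [hmq, ← hYL]
    have e : Y ^ q = Y ^ (q - 2) * Y ^ 2 := by
      rw [← Real.rpow_two, ← Real.rpow_add hY]; congr 1; ring
    rw [e, inv_mul_le_iff₀ (by positivity)]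
    have e2 : (2 * (ρ / 2 ^ k)) ^ (d + n) * (C * (2 ^ (d + n)) ^ k * (Y ^ (q - 2) * Y ^ 2))
        = 2 ^ (d + n) * (C * Y ^ (q - 2) * (Y ^ 2 * ρ ^ (d + n))) := by
      rw [mul_pow, div_pow, ← pow_mul, ← pow_mul, mul_comm k]
      field_simp
    rw [e2]
    have : (1:ℝ) ≤ 2 ^ (d + n) := one_le_pow₀ (by norm_num)
    exact le_mul_of_one_le_left (by positivity) this
  have hmeas : Measurable fun w => ‖u w‖ₑ ^ q := hc.enorm.measurable.pow_const q
  have hper : Per d n fun w => ‖u w‖ₑ ^ q := by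
    intro j p
    simp only [hu.2.1 j p]
  have b1 : ∫⁻ h, ‖u (z + h)‖ₑ ∂(nu d n (ρ / 2 ^ k)) ≤ ENNReal.ofReal m := by
    rw [← ENNReal.rpow_le_rpow_iff (by linarith : 0 < q)]
    refine (jensen _ (by linarith) _ ?_).trans ((mean_add _ hmeas hper z hr1).trans hB)
    exact (by fun_prop : Continuous fun h => u (z + h)).enorm.measurable.aemeasurable
  have b2 : ∫⁻ h, ‖u (z - h)‖ₑ ∂(nu d n (ρ / 2 ^ k)) ≤ ENNReal.ofReal m := by
    rw [← ENNReal.rpow_le_rpow_iff (by linarith : 0 < q)]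
    refine (jensen _ (by linarith) _ ?_).trans ((mean_sub _ hmeas hper z hr1).trans hB)
    exact (by fun_prop : Continuous fun h => u (z - h)).enorm.measurable.aemeasurable
  refine (split u hc hr z).trans (add_le_add le_rfl ?_)
  rw [two_mul, ENNReal.ofReal_add hm0 hm0]
  exact add_le_add b1 b2

lemma step {d n : ℕ} (hN : 0 < d + n) {q p : ℝ} (hq : 2 ≤ q) (hp : 2 ≤ p)
    (hqp : ((d:ℝ) + n) * (p - 2) < 4 * q) (h : GN d n q) : GN d n p := by
  obtain ⟨C, hC, h⟩ := h
  set b : ℝ := (2:ℝ) ^ (((d:ℝ) + n) / q) with hb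
  have hNR : (0:ℝ) < (d:ℝ) + n := by exact_mod_cast hN
  have hb0 : 0 < b := by positivity
  have hb1 : 1 < b := Real.one_lt_rpow (by norm_num) (by positivity)
  set c : ℝ := C ^ (1 / q) with hc
  have hc0 : 0 < c := by positivity
  set θ : ℝ := b ^ (p - 2) / 16 with hθ
  have hθ0 : 0 < θ := by positivity
  have hθ1 : θ < 1 := by
    rw [hθ, div_lt_one (by norm_num), hb, ← Real.rpow_mul (by norm_num)]
    have : (16:ℝ) = 2 ^ (4:ℝ) := by norm_num
    rw [this]
    apply Real.rpow_lt_rpow_of_exponent_lt (by norm_num)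
    rw [div_mul_eq_mul_div, div_lt_iff₀ (by linarith)]
    exact hqp
  set A : ℝ := 4 * ((d:ℝ) + n) ^ 2 * (4 * c) ^ (p - 2) * b ^ (p - 2) with hA
  have hA0 : 0 < A := by positivity
  refine ⟨(4 * c) ^ (p - 2) + A * (1 - θ)⁻¹, ?_, fun u hu hL => ?_⟩
  · have : 0 < 1 - θ := by linarith
    positivity
  have hI := h u hu hL
  have hLH := mass_le d n u
  have hml := mass_lint hu
  have hhl := hess_lint hu
  have hYdef : Yf d n u = √(Mass d n u) * (H2norm d n u / √(Mass d n u)) ^ (((d:ℝ) + n) / 4) := rfl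
  set L := √(Mass d n u) with hLdef
  set H := H2norm d n u with hHdef
  set Y := Yf d n u with hYd
  have hH : 0 < H := hL.trans_le hLH
  have hY : 0 < Y := by rw [hYdef]; positivity
  set ρ : ℝ := √(L / H) with hρ
  have hρ0 : 0 < ρ := Real.sqrt_pos.2 (by positivity)
  have hρ1 : ρ ≤ 1 := by
    rw [hρ, Real.sqrt_le_left (by norm_num), one_pow, div_le_one hH]; exact hLH
  have hρ2 : ρ ^ 2 = L / H := Real.sq_sqrt (by positivity)
  have hρ4 : ρ ^ 4 * H ^ 2 = L ^ 2 := by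
    have : ρ ^ 4 = (ρ ^ 2) ^ 2 := by ring
    rw [this, hρ2]; field_simp
  have hYL : Y ^ 2 * ρ ^ (d + n) = L ^ 2 := by
    have e1 : ρ ^ (d + n) = (L / H) ^ (((d:ℝ) + n) / 2) := by
      rw [hρ, Real.sqrt_eq_rpow, ← Real.rpow_natCast, ← Real.rpow_mul (by positivity)]
      congr 1; push_cast; ring
    have e2 : ((H / L) ^ (((d:ℝ) + n) / 4)) ^ 2 = (H / L) ^ (((d:ℝ) + n) / 2) := by
      rw [← Real.rpow_natCast, ← Real.rpow_mul (by positivity)]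
      congr 1; push_cast; ring
    rw [hYdef, mul_pow, e1, e2, mul_assoc, ← Real.mul_rpow (by positivity) (by positivity)]
    have : H / L * (L / H) = 1 := by field_simp
    rw [this, Real.one_rpow, mul_one]
  have mb := mean_bound hq hC u hu hY hρ0 hρ1 hYL hI
  have key := interp (μP d n) (fun z => ‖u z‖ₑ) hu.1.continuous.enorm.measurable
    (fun z => enorm_ne_top) (fun k => G u (ρ / 2 ^ k)) (fun k => G_meas u hu.1.continuous _)
    (fun k => ENNReal.ofReal (2 * (c * b ^ k * Y))) (by
      intro x hx
      obtain ⟨k, hk⟩ := pow_unbounded_of_one_lt (x.toReal / (c * Y)) hb1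
      refine ⟨k, ?_⟩
      rw [← ENNReal.ofReal_toReal hx]
      refine le_trans (ENNReal.ofReal_le_ofReal ?_) (le_mul_of_one_le_left zero_le one_le_two)
      rw [div_lt_iff₀ (by positivity)] at hk
      have : 0 ≤ c * b ^ k * Y := by positivity
      nlinarith) mb hp
  refine key.trans ?_
  have t0 : ∀ k : ℕ, (2 * ENNReal.ofReal (2 * (c * b ^ k * Y))) ^ (p - 2)
      = ENNReal.ofReal ((4 * c) ^ (p - 2) * (b ^ (p - 2)) ^ k * Y ^ (p - 2)) := by
    intro k
    have : (2 : ℝ≥0∞) = ENNReal.ofReal 2 := by simp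
    rw [this, ← ENNReal.ofReal_mul (by norm_num),
      ENNReal.ofReal_rpow_of_nonneg (by positivity) (by linarith)]
    congr 1
    rw [show 2 * (2 * (c * b ^ k * Y)) = (4 * c) * b ^ k * Y by ring,
      Real.mul_rpow (by positivity) hY.le, Real.mul_rpow (by positivity) (by positivity)]
    congr 2
    rw [← Real.rpow_natCast, ← Real.rpow_natCast, ← Real.rpow_mul hb0.le, ← Real.rpow_mul hb0.le,
      mul_comm]
  have t1 : ∀ k : ℕ, (2 * ENNReal.ofReal (2 * (c * b ^ (k + 1) * Y))) ^ (p - 2) *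
      (4 * ∫⁻ z, G u (ρ / 2 ^ k) z ^ 2 ∂(μP d n)) ≤
      ENNReal.ofReal (A * Y ^ (p - 2) * L ^ 2 * θ ^ k) := by
    intro k
    have hG := (G_bound u hu.1 hu.2.1 (r := ρ / 2 ^ k) (by positivity)).trans
      (mul_le_mul' le_rfl hhl)
    refine (mul_le_mul' le_rfl (mul_le_mul' le_rfl hG)).trans (le_of_eq ?_)
    have : (4 : ℝ≥0∞) = ENNReal.ofReal 4 := by simp
    rw [t0, this, ← ENNReal.ofReal_mul (by positivity), ← ENNReal.ofReal_mul (by positivity),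
      ← ENNReal.ofReal_mul (by positivity)]
    congr 1
    rw [hA, hθ, ← hρ4, div_pow, div_pow, ← pow_mul, mul_comm k 4, pow_mul 2 4 k, pow_succ]
    norm_num
    ring
  refine (add_le_add (le_of_eq (b := ENNReal.ofReal ((4 * c) ^ (p - 2) * Y ^ (p - 2) * L ^ 2)) ?_)
    (ENNReal.tsum_le_tsum t1)).trans (le_of_eq ?_)
  · rw [t0, hml, ← ENNReal.ofReal_mul (by positivity)]
    simp
  · have hs := summable_geometric_of_lt_one hθ0.le hθ1
    rw [← ENNReal.ofReal_tsum_of_nonneg (fun k => by positivity) (hs.mul_left _), tsum_mul_left,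
      tsum_geometric_of_lt_one hθ0.le hθ1, ← ENNReal.ofReal_add (by positivity)]
    · congr 1; ring
    · have : 0 < 1 - θ := by linarith
      positivity

lemma GN_two (d n : ℕ) : GN d n 2 := by
  refine ⟨1, one_pos, fun u hu _ => ?_⟩
  have := mass_lint hu
  simp only [ENNReal.rpow_two, this, sub_self, Real.rpow_zero, mul_one, one_mul]
  exact le_rfl

lemma GN_all {d n : ℕ} (hN : 0 < d + n) {p : ℝ} (hp : 2 ≤ p)
    (hs : ((d:ℝ) + n) * (p - 2) + 4 ≤ 4 * p) : GN d n p := by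
  have hNR : (0:ℝ) < (d:ℝ) + n := by exact_mod_cast hN
  have key : ∀ k : ℕ, GN d n (min p (2 + k / ((d:ℝ) + n))) := by
    intro k
    induction k with
    | zero =>
      simp only [Nat.cast_zero, zero_div, add_zero, min_eq_right hp]
      exact GN_two d n
    | succ k ih =>
      have h2 : ∀ k : ℕ, 2 ≤ min p (2 + k / ((d:ℝ) + n)) := fun k => by
        apply le_min hp
        have : (0:ℝ) ≤ k / ((d:ℝ) + n) := by positivity
        linarith
      refine step hN (h2 k) (h2 (k + 1)) ?_ ih
      set q := min p (2 + k / ((d:ℝ) + n)) with hq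
      have hqp : q ≤ p := min_le_left _ _
      have hq2 := h2 k
      rw [← hq] at hq2
      set q' := min p (2 + ((k + 1 : ℕ):ℝ) / ((d:ℝ) + n)) with hq'
      have hstep : q' ≤ q + 1 / ((d:ℝ) + n) := by
        rw [hq, min_add]
        apply min_le_min
        · have : 0 < 1 / ((d:ℝ) + n) := by positivity
          linarith
        · push_cast
          rw [add_div]; linarith
      have h3 : ((d:ℝ) + n) * (q' - 2) ≤ ((d:ℝ) + n) * (q - 2) + 1 := by
        have := mul_le_mul_of_nonneg_left hstep hNR.le
        rw [mul_add, mul_one_div_cancel hNR.ne'] at this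
        linarith
      have h4 : ((d:ℝ) + n) * (q - 2) + 4 ≤ 4 * q := by
        by_cases h : (d:ℝ) + n ≤ 4
        · nlinarith
        · nlinarith
      linarith
  obtain ⟨k, hk⟩ := exists_nat_ge ((p - 2) * ((d:ℝ) + n))
  have := key k
  rwa [min_eq_left] at this
  rw [← sub_le_iff_le_add', le_div_iff₀ hNR]
  exact hk

end BNLSAux

open BNLS in
/-- Gagliardo–Nirenberg inequality on `ℝ^d × 𝕋^n`. -/
theorem stmt_0 (d n : ℕ) (hd : 1 ≤ d) (hn : 1 ≤ n) (α : ℝ) (hα : 0 < α)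
    (hcrit : 4 < d + n → α < 4 / ((d : ℝ) + n - 4)) :
    ∃ C > (0:ℝ), ∀ u : Pt d n → ℂ, InH2 d n u →
      Npow d n (α+2) u ≤
        C * H2norm d n u ^ (α * ((d:ℝ)+n) / 4)
          * Real.sqrt (Mass d n u) ^ (α + 2 - α * ((d:ℝ)+n) / 4) := by
  have hN : 0 < d + n := by omega
  have hNR : (0:ℝ) < (d:ℝ) + n := by exact_mod_cast hN
  have hs : ((d:ℝ) + n) * α ≤ 4 * α + 4 := by
    by_cases h : 4 < d + n
    · have h4 : (4:ℝ) < (d:ℝ) + n := by exact_mod_cast h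
      have := hcrit h
      rw [lt_div_iff₀ (by linarith)] at this
      linarith
    · have h4 : (d:ℝ) + n ≤ 4 := by exact_mod_cast (not_lt.1 h)
      nlinarith
  obtain ⟨C, hC, hGN⟩ := BNLSAux.GN_all hN (p := α + 2) (by linarith) (by linarith)
  refine ⟨C, hC, fun u hu => ?_⟩
  have hH0 : 0 ≤ H2norm d n u := Real.sqrt_nonneg _
  have hmeas : AEStronglyMeasurable (fun z => ‖u z‖ ^ (α + 2)) (μP d n) := by
    apply Continuous.aestronglyMeasurable
    exact hu.1.continuous.norm.rpow_const fun z => Or.inr (by linarith)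
  have hle : Npow d n (α + 2) u = (∫⁻ z, ‖u z‖ₑ ^ (α + 2) ∂(μP d n)).toReal := by
    unfold Npow
    rw [integral_eq_lintegral_of_nonneg_ae (Eventually.of_forall fun z => by positivity) hmeas]
    congr 1
    refine lintegral_congr fun z => ?_
    rw [← ENNReal.ofReal_rpow_of_nonneg (norm_nonneg _) (by linarith), ofReal_norm]
  rcases (Real.sqrt_nonneg (Mass d n u)).eq_or_lt with hL | hL
  · have hz := BNLSAux.mass_lint hu
    rw [← hL] at hz
    have hz2 : (fun z => ‖u z‖ₑ ^ 2) =ᵐ[μP d n] 0 := by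
      rw [← lintegral_eq_zero_iff (hu.1.continuous.enorm.measurable.pow_const 2)]
      simpa using hz
    have : ∫⁻ z, ‖u z‖ₑ ^ (α + 2) ∂(μP d n) = 0 := by
      rw [lintegral_eq_zero_iff (hu.1.continuous.enorm.measurable.pow_const (α + 2))]
      filter_upwards [hz2] with z hz3
      have : u z = 0 := by simpa using hz3
      simp [this]
      linarith
    rw [hle, this]
    simp only [ENNReal.toReal_zero]
    positivity
  · have hLH := BNLSAux.mass_le d n u
    have h1 := hGN u hu hL
    rw [hle]
    have hH : 0 < H2norm d n u := hL.trans_le hLH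
    refine ENNReal.toReal_le_of_le_ofReal (by positivity) (h1.trans (le_of_eq ?_))
    congr 1
    unfold BNLSAux.Yf
    set L := √(Mass d n u)
    set H := H2norm d n u
    rw [show α + 2 - 2 = α by ring, Real.mul_rpow hL.le (by positivity),
      ← Real.rpow_mul (by positivity), Real.div_rpow hH.le hL.le,
      show ((d:ℝ) + n) / 4 * α = α * ((d:ℝ) + n) / 4 by ring, Real.rpow_sub hL, Real.rpow_add hL,
      Real.rpow_two]
    field_simp
end
end

section
/- Let β < 0 and c > 0. Then the infimum of ‖Δu‖_{L²}² + β‖∇u‖_{L²}² over all u ∈ H²(ℝ^d × 𝕋^n) with ‖u‖_{L²}² = c equals -β²c/4. -/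
noncomputable section

open MeasureTheory Real Filter Set

namespace BNLS

section helpers

variable {d n : ℕ}

instance instFiniteMuT (n : ℕ) : IsFiniteMeasure (μT n) := by
  unfold μT
  refine ⟨?_⟩
  rw [Measure.restrict_apply_univ]
  unfold torusBox
  rw [Real.volume_pi_Ico]
  exact ENNReal.prod_lt_top (fun _ _ => ENNReal.ofReal_lt_top)

lemma contDiff_dX {m k : WithTop ℕ∞} {u : Pt d n → ℂ} (hu : ContDiff ℝ m u) (hk : k + 1 ≤ m)
    (i : Fin d) : ContDiff ℝ k (dX d n i u) := by
  unfold dX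
  exact (hu.fderiv_right hk).clm_apply contDiff_const

lemma contDiff_dY {m k : WithTop ℕ∞} {u : Pt d n → ℂ} (hu : ContDiff ℝ m u) (hk : k + 1 ≤ m)
    (j : Fin n) : ContDiff ℝ k (dY d n j u) := by
  unfold dY
  exact (hu.fderiv_right hk).clm_apply contDiff_const

lemma integral_dX_eq_zero (i : Fin d) (F : Pt d n → ℂ) (hF : ContDiff ℝ 1 F)
    (h1 : Integrable F (μP d n)) (h2 : Integrable (dX d n i F) (μP d n)) :
    ∫ z, dX d n i F z ∂(μP d n) = 0 := by
  unfold μP at *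
  rw [integral_prod_symm _ h2]
  rw [← integral_zero (Fin n → ℝ) ℂ (μ := μT n)]
  apply integral_congr_ae
  filter_upwards [h1.prod_left_ae, h2.prod_left_ae] with y hy1 hy2
  have hder : ∀ x, HasFDerivAt (fun x => F (x, y))
      ((fderiv ℝ F (x, y)).comp (ContinuousLinearMap.inl ℝ _ _)) x := by
    intro x
    have := (hF.differentiable one_ne_zero (x, y)).hasFDerivAt
    exact this.comp x (hasFDerivAt_prodMk_left x y)
  have key := integral_mul_fderiv_eq_neg_fderiv_mul_of_integrable (𝕜 := ℂ)
    (μ := (volume : Measure (Fin d → ℝ)))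
    (f := fun _ => (1 : ℂ)) (g := fun x => F (x, y)) (v := Pi.single i 1) (by simp)
    (by
      simp only [(hder _).fderiv, one_mul]
      simpa [dX] using hy2) (by simpa using hy1) (by intros; fun_prop)
    (by intro x _; exact (hder x).differentiableAt)
  simp only [(hder _).fderiv, one_mul] at key
  simpa [dX] using key

lemma integral_dY_eq_zero (j : Fin n) (F : Pt d n → ℂ) (hF : ContDiff ℝ 1 F)
    (hper : ∀ p : Pt d n, F (p.1, p.2 + (2*π) • (Pi.single j 1 : Fin n → ℝ)) = F p)
    (h2 : Integrable (dY d n j F) (μP d n)) :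
    ∫ z, dY d n j F z ∂(μP d n) = 0 := by
  have hcont := (contDiff_dY (k := 0) hF (by simp) j).continuous
  unfold μP at *
  rw [integral_prod _ h2]
  rw [← integral_zero (Fin d → ℝ) ℂ (μ := volume)]
  congr 1
  ext x
  obtain _ | m := n
  · exact j.elim0
  have hbox : μT (m+1) = volume.restrict (Icc (0 : Fin (m+1) → ℝ) (fun _ => 2*π)) := by
    unfold μT torusBox
    apply Measure.restrict_congr_set
    exact Measure.univ_pi_Ico_ae_eq_Icc (f := (0 : Fin (m+1) → ℝ)) (g := fun _ => 2*π)
  rw [hbox]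
  have hder : ∀ y, HasFDerivAt (fun y => F (x, y))
      ((fderiv ℝ F (x, y)).comp (ContinuousLinearMap.inr ℝ _ _)) y := by
    intro y
    have := (hF.differentiable one_ne_zero (x, y)).hasFDerivAt
    exact this.comp y (hasFDerivAt_prodMk_right x y)
  have hsum : ∀ y, ∑ i, (if i = j then ((fderiv ℝ F (x, y)).comp
      (ContinuousLinearMap.inr ℝ (Fin d → ℝ) (Fin (m+1) → ℝ))) else 0) (Pi.single i 1)
      = dY d (m+1) j F (x, y) := by
    intro y
    rw [Finset.sum_eq_single j]
    · simp [dY]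
    · intro i _ hi; simp [hi]
    · simp
  have key := integral_divergence_of_hasFDerivAt_off_countable'
    (0 : Fin (m+1) → ℝ) (fun _ => 2*π) (fun _ => by simp; positivity)
    (fun i y => if i = j then F (x, y) else 0)
    (fun i y => if i = j then ((fderiv ℝ F (x, y)).comp
      (ContinuousLinearMap.inr ℝ (Fin d → ℝ) (Fin (m+1) → ℝ))) else 0) ∅ countable_empty
    (by
      intro i
      have := hF.continuous
      by_cases h : i = j
      · simp only [h, if_true]; fun_prop
      · simp only [h, if_false]; fun_prop)
    (by
      intro y _ i
      by_cases h : i = j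
      · simp only [h, if_true]; exact hder y
      · simp only [h, if_false]; exact hasFDerivAt_const _ _)
    (by
      simp only [hsum]
      apply ContinuousOn.integrableOn_compact isCompact_Icc
      fun_prop)
  simp only [hsum] at key
  rw [key]
  apply Finset.sum_eq_zero
  intro i _
  by_cases h : i = j
  · subst h
    simp only [if_true]
    rw [sub_eq_zero]
    congr 1
    ext y
    have := hper (x, Fin.insertNth i (0:ℝ) y)
    simp only [Pi.zero_apply] at this ⊢
    rw [← this]
    congr 2
    ext k
    refine Fin.succAboveCases i ?_ ?_ k
    · simp
    · intro k; simp
  · simp [h]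

end helpers

end BNLS
namespace BNLS

section helpers2

variable {d n : ℕ}

lemma memLp_of_sq {f : Pt d n → ℂ} (hf : Continuous f)
    (h : Integrable (fun z => ‖f z‖^2) (μP d n)) : MemLp f 2 (μP d n) :=
  (memLp_two_iff_integrable_sq_norm hf.aestronglyMeasurable).2 h

lemma memLp_of_le {f : Pt d n → ℂ} {g : Pt d n → ℝ} (hf : Continuous f)
    (hg : Integrable g (μP d n)) (h : ∀ z, ‖f z‖^2 ≤ g z) : MemLp f 2 (μP d n) := by
  apply memLp_of_sq hf
  refine hg.mono' (by fun_prop) (Eventually.of_forall fun z => ?_)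
  simpa using h z

lemma integrable_conj_mul {f g : Pt d n → ℂ} (hf : MemLp f 2 (μP d n)) (hg : MemLp g 2 (μP d n)) :
    Integrable (fun z => starRingEnd ℂ (f z) * g z) (μP d n) :=
  MemLp.integrable_mul (hf.star) hg

lemma fderiv_conj_mul {u v : Pt d n → ℂ} {p : Pt d n} (hu : DifferentiableAt ℝ u p)
    (hv : DifferentiableAt ℝ v p) (w : Pt d n) :
    fderiv ℝ (fun p => starRingEnd ℂ (u p) * v p) p w =
      starRingEnd ℂ (u p) * fderiv ℝ v p w + starRingEnd ℂ (fderiv ℝ u p w) * v p := by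
  have h1 : HasFDerivAt (fun p => starRingEnd ℂ (u p))
      ((Complex.conjCLE : ℂ →L[ℝ] ℂ).comp (fderiv ℝ u p)) p :=
    (Complex.conjCLE : ℂ →L[ℝ] ℂ).hasFDerivAt.comp p hu.hasFDerivAt
  have h2 : HasFDerivAt (fun p => starRingEnd ℂ (u p) * v p) _ p := h1.mul hv.hasFDerivAt
  rw [h2.fderiv]
  simp [mul_comm]

lemma ibp_aux {u v w : Pt d n → ℂ} (hu : MemLp u 2 (μP d n)) (hv : MemLp v 2 (μP d n))
    (hw : MemLp w 2 (μP d n))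
    (h : ∫ z, (starRingEnd ℂ (u z) * w z + starRingEnd ℂ (v z) * v z) ∂(μP d n) = 0) :
    ∫ z, (starRingEnd ℂ (u z) * w z).re ∂(μP d n) = - ∫ z, ‖v z‖^2 ∂(μP d n) := by
  have i1 := integrable_conj_mul hu hw
  have i2 := integrable_conj_mul hv hv
  rw [integral_add i1 i2] at h
  have h' := congrArg Complex.re h
  rw [Complex.add_re] at h'
  have e1 := integral_re i1
  have e2 := integral_re i2
  simp only [RCLike.re_to_complex] at e1 e2
  rw [← e1, ← e2] at h'
  have e3 : ∀ z, (starRingEnd ℂ (v z) * v z).re = ‖v z‖^2 := by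
    intro z
    rw [← Complex.normSq_eq_conj_mul_self, Complex.ofReal_re, Complex.normSq_eq_norm_sq]
  simp only [e3, Complex.zero_re] at h'
  linarith

lemma ibpX {u : Pt d n → ℂ} (hc : ContDiff ℝ 2 u) (i : Fin d) (hu : MemLp u 2 (μP d n))
    (hv : MemLp (dX d n i u) 2 (μP d n)) (hw : MemLp (dX d n i (dX d n i u)) 2 (μP d n)) :
    ∫ z, (starRingEnd ℂ (u z) * dX d n i (dX d n i u) z).re ∂(μP d n)
      = - ∫ z, ‖dX d n i u z‖^2 ∂(μP d n) := by
  have hv1 : ContDiff ℝ 1 (dX d n i u) := contDiff_dX hc (by norm_num) i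
  have hu1 : ContDiff ℝ 1 u := hc.of_le (by norm_num)
  have hF : ContDiff ℝ 1 (fun p => starRingEnd ℂ (u p) * dX d n i u p) :=
    ((Complex.conjCLE : ℂ →L[ℝ] ℂ).contDiff.comp hu1).mul hv1
  have hd : dX d n i (fun p => starRingEnd ℂ (u p) * dX d n i u p) = fun z =>
      starRingEnd ℂ (u z) * dX d n i (dX d n i u) z
        + starRingEnd ℂ (dX d n i u z) * dX d n i u z := by
    ext z
    exact fderiv_conj_mul (hu1.differentiable one_ne_zero z) (hv1.differentiable one_ne_zero z) _
  apply ibp_aux hu hv hw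
  have := integral_dX_eq_zero i _ hF (integrable_conj_mul hu hv)
    (by rw [hd]; exact (integrable_conj_mul hu hw).add (integrable_conj_mul hv hv))
  rwa [hd] at this

lemma dY_periodic {u : Pt d n → ℂ} (hp : Periodic d n u) (j k : Fin n) (p : Pt d n) :
    dY d n j u (p.1, p.2 + (2*π) • (Pi.single k 1 : Fin n → ℝ)) = dY d n j u p := by
  have h : (fun q : Pt d n => u (q + (0, (2*π) • (Pi.single k 1 : Fin n → ℝ)))) = u := by
    ext q
    have := hp k q
    rw [← this]
    congr 1
    ext <;> simp
  unfold dY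
  conv_rhs => rw [← h]
  rw [fderiv_comp_add_right]
  congr 2
  ext <;> simp

lemma ibpY {u : Pt d n → ℂ} (hc : ContDiff ℝ 2 u) (hp : Periodic d n u)
    (i : Fin n) (hu : MemLp u 2 (μP d n))
    (hv : MemLp (dY d n i u) 2 (μP d n)) (hw : MemLp (dY d n i (dY d n i u)) 2 (μP d n)) :
    ∫ z, (starRingEnd ℂ (u z) * dY d n i (dY d n i u) z).re ∂(μP d n)
      = - ∫ z, ‖dY d n i u z‖^2 ∂(μP d n) := by
  have hv1 : ContDiff ℝ 1 (dY d n i u) := contDiff_dY hc (by norm_num) i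
  have hu1 : ContDiff ℝ 1 u := hc.of_le (by norm_num)
  have hF : ContDiff ℝ 1 (fun p => starRingEnd ℂ (u p) * dY d n i u p) :=
    ((Complex.conjCLE : ℂ →L[ℝ] ℂ).contDiff.comp hu1).mul hv1
  have hd : dY d n i (fun p => starRingEnd ℂ (u p) * dY d n i u p) = fun z =>
      starRingEnd ℂ (u z) * dY d n i (dY d n i u) z
        + starRingEnd ℂ (dY d n i u z) * dY d n i u z := by
    ext z
    exact fderiv_conj_mul (hu1.differentiable one_ne_zero z) (hv1.differentiable one_ne_zero z) _
  apply ibp_aux hu hv hw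
  have := integral_dY_eq_zero i _ hF
    (by intro p; rw [hp i p, dY_periodic hp i i p])
    (by rw [hd]; exact (integrable_conj_mul hu hw).add (integrable_conj_mul hv hv))
  rwa [hd] at this

set_option maxHeartbeats 1000000 in
lemma energy_identity {u : Pt d n → ℂ} (h : InH2 d n u) (β : ℝ) :
    lapSq d n u + β * gradSq d n u =
      (∫ z, ‖lap d n u z - ((β/2 : ℝ) : ℂ) * u z‖^2 ∂(μP d n)) - β^2/4 * Mass d n u := by
  obtain ⟨hc, hp, hm, hg, hh⟩ := h
  have mu : MemLp u 2 (μP d n) := memLp_of_sq hc.continuous hm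
  have cX : ∀ i, ContDiff ℝ 1 (dX d n i u) := fun i => contDiff_dX hc (by norm_num) i
  have cY : ∀ i, ContDiff ℝ 1 (dY d n i u) := fun i => contDiff_dY hc (by norm_num) i
  have mX : ∀ i, MemLp (dX d n i u) 2 (μP d n) := fun i => by
    refine memLp_of_le (cX i).continuous hg fun z => ?_
    have := Finset.single_le_sum (f := fun i => ‖dX d n i u z‖^2)
      (fun _ _ => sq_nonneg _) (Finset.mem_univ i)
    have h2 : 0 ≤ ∑ j, ‖dY d n j u z‖^2 := Finset.sum_nonneg fun _ _ => sq_nonneg _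
    linarith
  have mY : ∀ i, MemLp (dY d n i u) 2 (μP d n) := fun i => by
    refine memLp_of_le (cY i).continuous hg fun z => ?_
    have := Finset.single_le_sum (f := fun i => ‖dY d n i u z‖^2)
      (fun _ _ => sq_nonneg _) (Finset.mem_univ i)
    have h2 : 0 ≤ ∑ j, ‖dX d n j u z‖^2 := Finset.sum_nonneg fun _ _ => sq_nonneg _
    linarith
  have mXX : ∀ i, MemLp (dX d n i (dX d n i u)) 2 (μP d n) := fun i => by
    refine memLp_of_le (contDiff_dX (k := 0) (cX i) (by simp) i).continuous hh fun z => ?_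
    have h1 := Finset.single_le_sum (f := fun i' => ‖dX d n i (dX d n i' u) z‖^2)
      (fun _ _ => sq_nonneg _) (Finset.mem_univ i)
    have h2 := Finset.single_le_sum (f := fun i => ∑ i', ‖dX d n i (dX d n i' u) z‖^2)
      (fun _ _ => Finset.sum_nonneg fun _ _ => sq_nonneg _) (Finset.mem_univ i)
    have h3 : 0 ≤ (∑ i, ∑ j, ‖dY d n j (dX d n i u) z‖^2)
      + (∑ j, ∑ i, ‖dX d n i (dY d n j u) z‖^2) + (∑ j, ∑ j', ‖dY d n j (dY d n j' u) z‖^2) := by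
      exact add_nonneg (add_nonneg (Finset.sum_nonneg fun _ _ => Finset.sum_nonneg fun _ _ => sq_nonneg _)
        (Finset.sum_nonneg fun _ _ => Finset.sum_nonneg fun _ _ => sq_nonneg _)) (Finset.sum_nonneg fun _ _ => Finset.sum_nonneg fun _ _ => sq_nonneg _)
    unfold hessInt
    linarith
  have mYY : ∀ i, MemLp (dY d n i (dY d n i u)) 2 (μP d n) := fun i => by
    refine memLp_of_le (contDiff_dY (k := 0) (cY i) (by simp) i).continuous hh fun z => ?_
    have h1 := Finset.single_le_sum (f := fun i' => ‖dY d n i (dY d n i' u) z‖^2)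
      (fun _ _ => sq_nonneg _) (Finset.mem_univ i)
    have h2 := Finset.single_le_sum (f := fun i => ∑ i', ‖dY d n i (dY d n i' u) z‖^2)
      (fun _ _ => Finset.sum_nonneg fun _ _ => sq_nonneg _) (Finset.mem_univ i)
    have h3 : 0 ≤ (∑ i, ∑ i', ‖dX d n i (dX d n i' u) z‖^2)
      + (∑ i, ∑ j, ‖dY d n j (dX d n i u) z‖^2)
      + (∑ j, ∑ i, ‖dX d n i (dY d n j u) z‖^2) := by
      exact add_nonneg (add_nonneg (Finset.sum_nonneg fun _ _ => Finset.sum_nonneg fun _ _ => sq_nonneg _)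
        (Finset.sum_nonneg fun _ _ => Finset.sum_nonneg fun _ _ => sq_nonneg _)) (Finset.sum_nonneg fun _ _ => Finset.sum_nonneg fun _ _ => sq_nonneg _)
    unfold hessInt
    linarith
  have ml : MemLp (lap d n u) 2 (μP d n) :=
    (memLp_finsetSum _ fun i _ => mXX i).add (memLp_finsetSum _ fun i _ => mYY i)
  have il : Integrable (fun z => ‖lap d n u z‖^2) (μP d n) :=
    (memLp_two_iff_integrable_sq_norm ml.1).1 ml
  have icross : Integrable (fun z => (starRingEnd ℂ (u z) * lap d n u z).re) (μP d n) :=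
    (integrable_conj_mul mu ml).re
  have gX : gradXSq d n u = ∑ i, ∫ z, ‖dX d n i u z‖^2 ∂(μP d n) :=
    integral_finsetSum _ fun i _ => (memLp_two_iff_integrable_sq_norm (mX i).1).1 (mX i)
  have gY : gradYSq d n u = ∑ i, ∫ z, ‖dY d n i u z‖^2 ∂(μP d n) :=
    integral_finsetSum _ fun i _ => (memLp_two_iff_integrable_sq_norm (mY i).1).1 (mY i)
  have iXX : ∀ i, Integrable
      (fun z => (starRingEnd ℂ (u z) * dX d n i (dX d n i u) z).re) (μP d n) :=
    fun i => (integrable_conj_mul mu (mXX i)).re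
  have iYY : ∀ i, Integrable
      (fun z => (starRingEnd ℂ (u z) * dY d n i (dY d n i u) z).re) (μP d n) :=
    fun i => (integrable_conj_mul mu (mYY i)).re
  have hcross : ∫ z, (starRingEnd ℂ (u z) * lap d n u z).re ∂(μP d n) = - gradSq d n u := by
    have e : ∀ z, (starRingEnd ℂ (u z) * lap d n u z).re =
        (∑ i, (starRingEnd ℂ (u z) * dX d n i (dX d n i u) z).re) +
        ∑ i, (starRingEnd ℂ (u z) * dY d n i (dY d n i u) z).re := by
      intro z
      simp only [lap, lapX, lapY, mul_add, Finset.mul_sum, Complex.add_re, Complex.re_sum]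
    simp only [e]
    rw [integral_add (integrable_finsetSum _ fun i _ => iXX i)
      (integrable_finsetSum _ fun i _ => iYY i),
      integral_finsetSum _ fun i _ => iXX i, integral_finsetSum _ fun i _ => iYY i]
    simp only [ibpX hc _ mu (mX _) (mXX _), ibpY hc hp _ mu (mY _) (mYY _),
      Finset.sum_neg_distrib]
    unfold gradSq
    rw [gX, gY]
    ring
  have e : ∀ z, ‖lap d n u z - ((β/2 : ℝ) : ℂ) * u z‖^2 = ‖lap d n u z‖^2
      - β * (starRingEnd ℂ (u z) * lap d n u z).re + β^2/4 * ‖u z‖^2 := by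
    intro z
    rw [← Complex.normSq_eq_norm_sq, ← Complex.normSq_eq_norm_sq, ← Complex.normSq_eq_norm_sq]
    simp [Complex.normSq_apply]
    ring
  simp only [e]
  have isub : Integrable (fun z => ‖lap d n u z‖^2
      - β * (starRingEnd ℂ (u z) * lap d n u z).re) (μP d n) := il.sub (icross.const_mul β)
  rw [integral_add isub (hm.const_mul _),
    integral_sub il (icross.const_mul β), integral_const_mul, integral_const_mul, hcross]
  unfold lapSq Mass
  ring

end helpers2

end BNLS
namespace BNLS

section helpers3

variable {d n : ℕ}

/-- Modulated, rescaled profile. -/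
def wave (n : ℕ) (ε k : ℝ) (i0 : Fin d) (h : (Fin d → ℝ) → ℂ) : Pt d n → ℂ :=
  fun p => Complex.exp (Complex.I * ((k * p.1 i0 : ℝ) : ℂ)) * h (ε • p.1)

/-- Conjugated derivative acting on profiles. -/
def cder (ε k : ℝ) (i0 i : Fin d) (h : (Fin d → ℝ) → ℂ) : (Fin d → ℝ) → ℂ :=
  fun x => (if i = i0 then Complex.I * (k : ℂ) else 0) * h x
    + (ε : ℂ) * fderiv ℝ h x (Pi.single i 1)

/-- Test functions. -/
def IsTest (h : (Fin d → ℝ) → ℂ) : Prop :=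
  ContDiff ℝ ((⊤ : ℕ∞) : WithTop ℕ∞) h ∧ HasCompactSupport h

lemma IsTest.deriv {h : (Fin d → ℝ) → ℂ} (hh : IsTest h) (v : Fin d → ℝ) :
    IsTest (fun x => fderiv ℝ h x v) :=
  ⟨(hh.1.fderiv_right (by simp)).clm_apply contDiff_const, hh.2.fderiv_apply ℝ v⟩

lemma IsTest.const_mul {h : (Fin d → ℝ) → ℂ} (hh : IsTest h) (a : ℂ) :
    IsTest (fun x => a * h x) :=
  ⟨contDiff_const.mul hh.1, hh.2.mul_left⟩

lemma IsTest.add {h g : (Fin d → ℝ) → ℂ} (hh : IsTest h) (hg : IsTest g) :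
    IsTest (fun x => h x + g x) :=
  ⟨hh.1.add hg.1, hh.2.add hg.2⟩

lemma IsTest.cder {h : (Fin d → ℝ) → ℂ} (hh : IsTest h) (ε k : ℝ) (i0 i : Fin d) :
    IsTest (cder ε k i0 i h) :=
  (hh.const_mul _).add ((hh.deriv _).const_mul _)

lemma IsTest.integrable {h : (Fin d → ℝ) → ℂ} (hh : IsTest h) :
    Integrable (fun x => ‖h x‖^2) := by
  refine Continuous.integrable_of_hasCompactSupport (by have := hh.1.continuous; fun_prop) ?_
  exact hh.2.comp_left (g := fun z : ℂ => ‖z‖^2) (by simp)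

lemma norm_wave (ε k : ℝ) (i0 : Fin d) (h : (Fin d → ℝ) → ℂ) (p : Pt d n) :
    ‖wave n ε k i0 h p‖ = ‖h (ε • p.1)‖ := by
  unfold wave
  rw [norm_mul, mul_comm Complex.I, Complex.norm_exp_ofReal_mul_I, one_mul]

lemma wave_hasFDerivAt (ε k : ℝ) (i0 : Fin d) {h : (Fin d → ℝ) → ℂ} (hh : IsTest h) (p : Pt d n)
    (v : Pt d n) :
    fderiv ℝ (wave n ε k i0 h) p v =
      Complex.exp (Complex.I * ((k * p.1 i0 : ℝ) : ℂ)) *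
      ((Complex.I * ((k * v.1 i0 : ℝ) : ℂ)) * h (ε • p.1)
        + (ε : ℂ) * fderiv ℝ h (ε • p.1) v.1) := by
  let ℓ : Pt d n →L[ℝ] ℂ := (Complex.I : ℂ) • (Complex.ofRealCLM.comp
    (k • (ContinuousLinearMap.proj (R := ℝ) (φ := fun _ : Fin d => ℝ) i0).comp
      (ContinuousLinearMap.fst ℝ (Fin d → ℝ) (Fin n → ℝ))))
  have hℓ : ∀ q : Pt d n, ℓ q = Complex.I * ((k * q.1 i0 : ℝ) : ℂ) := by
    intro q; simp [ℓ]
  let m : Pt d n →L[ℝ] (Fin d → ℝ) := ε • ContinuousLinearMap.fst ℝ (Fin d → ℝ) (Fin n → ℝ)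
  have hm : ∀ q : Pt d n, m q = ε • q.1 := fun q => by simp [m]
  have h1 : HasFDerivAt (fun q => Complex.exp (ℓ q)) (Complex.exp (ℓ p) • ℓ) p :=
    ℓ.hasFDerivAt.cexp
  have hsm : fderiv ℝ h (ε • p.1) (ε • v.1) = (ε : ℂ) * fderiv ℝ h (ε • p.1) v.1 := by
    rw [(fderiv ℝ h (ε • p.1)).map_smul, Complex.real_smul]
  have h2 : HasFDerivAt (fun q => h (m q)) ((fderiv ℝ h (m p)).comp m) p :=
    ((hh.1.differentiable (by simp) (m p)).hasFDerivAt).comp p m.hasFDerivAt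
  have hw : wave n ε k i0 h = (fun q => Complex.exp (ℓ q)) * (fun q => h (m q)) := by
    ext q
    simp only [wave, Pi.mul_apply, hℓ, hm]
  have h3 := h1.mul h2
  rw [← hw] at h3
  rw [h3.fderiv]
  simp only [add_apply, smul_apply,
    ContinuousLinearMap.comp_apply, smul_eq_mul, hℓ, hm, hsm]
  ring

lemma dX_wave (ε k : ℝ) (i0 i : Fin d) {h : (Fin d → ℝ) → ℂ} (hh : IsTest h) :
    dX d n i (wave n ε k i0 h) = wave n ε k i0 (cder ε k i0 i h) := by
  ext p
  unfold dX
  rw [wave_hasFDerivAt ε k i0 hh]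
  unfold wave cder
  by_cases hi : i = i0
  · subst hi; simp
  · simp [hi, Ne.symm hi]

lemma dY_wave (ε k : ℝ) (i0 : Fin d) (j : Fin n) {h : (Fin d → ℝ) → ℂ} (hh : IsTest h) :
    dY d n j (wave n ε k i0 h) = fun _ => 0 := by
  ext p
  unfold dY
  rw [wave_hasFDerivAt ε k i0 hh]
  simp

lemma dX_zero (i : Fin d) : dX d n i (fun _ => 0) = fun _ => 0 := by
  ext p; simp [dX]

lemma dY_zero (i : Fin n) : dY d n i (fun _ => 0) = fun _ => 0 := by
  ext p; simp [dY]

lemma wave_integrable {ε : ℝ} (hε : 0 < ε) (k : ℝ) (i0 : Fin d) {h : (Fin d → ℝ) → ℂ}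
    (hh : IsTest h) : Integrable (fun z => ‖wave n ε k i0 h z‖^2) (μP d n) := by
  simp only [norm_wave]
  have := (hh.integrable.comp_smul hε.ne')
  exact this.comp_fst (μT n)

lemma wave_integral {ε : ℝ} (hε : 0 < ε) (k : ℝ) (i0 : Fin d) (h : (Fin d → ℝ) → ℂ) :
    ∫ z, ‖wave n ε k i0 h z‖^2 ∂(μP d n) =
      (μT n).real univ * ((ε^d)⁻¹ * ∫ x, ‖h x‖^2) := by
  simp only [norm_wave]
  unfold μP
  rw [integral_fun_fst (fun x : Fin d → ℝ => ‖h (ε • x)‖^2)]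
  rw [Measure.integral_comp_smul_of_nonneg volume (fun x : Fin d → ℝ => ‖h x‖^2) ε (hR := hε.le)]
  simp

lemma wave_inH2 {ε : ℝ} (hε : 0 < ε) (k : ℝ) (i0 : Fin d) {h : (Fin d → ℝ) → ℂ}
    (hh : IsTest h) : InH2 d n (wave n ε k i0 h) := by
  refine ⟨?_, ?_, wave_integrable hε k i0 hh, ?_, ?_⟩
  · have h1 : ContDiff ℝ 2 h := hh.1.of_le (WithTop.coe_le_coe.2 (le_top : (2 : ℕ∞) ≤ ⊤))
    unfold wave
    have h2 : ContDiff ℝ 2 (fun p : Pt d n => h (ε • p.1)) :=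
      h1.comp (contDiff_fst.const_smul ε)
    refine ContDiff.mul (ContDiff.cexp (contDiff_const.mul ?_)) h2
    refine Complex.ofRealCLM.contDiff.comp (contDiff_const.mul ?_)
    exact (contDiff_apply ℝ ℝ i0).comp contDiff_fst
  · intro j p
    rfl
  · simp only [dX_wave ε k i0 _ hh, dY_wave ε k i0 _ hh]
    simp only [norm_zero, ne_eq, OfNat.ofNat_ne_zero, not_false_eq_true, zero_pow,
      Finset.sum_const_zero, add_zero]
    exact integrable_finsetSum _ fun i _ => wave_integrable hε k i0 (hh.cder _ _ _ _)
  · unfold hessInt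
    simp only [dX_wave ε k i0 _ hh, dY_wave ε k i0 _ hh, dX_zero, dY_zero,
      dX_wave ε k i0 _ (hh.cder _ _ _ _), dY_wave ε k i0 _ (hh.cder _ _ _ _)]
    simp only [norm_zero, ne_eq, OfNat.ofNat_ne_zero, not_false_eq_true, zero_pow,
      Finset.sum_const_zero, add_zero]
    exact integrable_finsetSum _ fun i _ => integrable_finsetSum _ fun i' _ =>
      wave_integrable hε k i0 ((hh.cder _ _ _ _).cder _ _ _ _)

lemma cder_cder (ε k : ℝ) (i0 i : Fin d) {h : (Fin d → ℝ) → ℂ} (hh : IsTest h) (x : Fin d → ℝ) :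
    cder ε k i0 i (cder ε k i0 i h) x =
      (if i = i0 then -(k:ℂ)^2 * h x +
        2 * Complex.I * k * ε * fderiv ℝ h x (Pi.single i0 1) else 0)
      + (ε : ℂ)^2 * fderiv ℝ (fun y => fderiv ℝ h y (Pi.single i 1)) x (Pi.single i 1) := by
  have d1 : DifferentiableAt ℝ h x := hh.1.differentiable (by simp) x
  have d2 : DifferentiableAt ℝ (fun y => fderiv ℝ h y (Pi.single i 1)) x :=
    (hh.deriv _).1.differentiable (by simp) x
  have e : fderiv ℝ (cder ε k i0 i h) x (Pi.single i 1) =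
      (if i = i0 then Complex.I * (k : ℂ) else 0) * fderiv ℝ h x (Pi.single i 1) +
      (ε : ℂ) * fderiv ℝ (fun y => fderiv ℝ h y (Pi.single i 1)) x (Pi.single i 1) := by
    have : HasFDerivAt (cder ε k i0 i h) _ x :=
      (d1.hasFDerivAt.const_mul (if i = i0 then Complex.I * (k : ℂ) else 0)).add
        (d2.hasFDerivAt.const_mul (ε : ℂ))
    rw [this.fderiv]
    simp only [add_apply, smul_apply, smul_eq_mul]
  change (if i = i0 then Complex.I * (k : ℂ) else 0) * cder ε k i0 i h x
    + (ε : ℂ) * fderiv ℝ (cder ε k i0 i h) x (Pi.single i 1) = _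
  rw [e]
  unfold cder
  by_cases hi : i = i0
  · subst hi
    simp only [if_true]
    linear_combination (k:ℂ)^2 * h x * Complex.I_sq
  · simp only [hi, if_false]
    ring

/-- Laplacian of a profile. -/
def lapP (h : (Fin d → ℝ) → ℂ) (x : Fin d → ℝ) : ℂ :=
  ∑ i, fderiv ℝ (fun y => fderiv ℝ h y (Pi.single i 1)) x (Pi.single i 1)

lemma lap_wave (ε k : ℝ) (i0 : Fin d) {h : (Fin d → ℝ) → ℂ} (hh : IsTest h) (z : Pt d n) :
    lap d n (wave n ε k i0 h) z + (k:ℂ)^2 * wave n ε k i0 h z =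
      wave n ε k i0 (fun x => (ε : ℂ) * (2 * Complex.I * k * fderiv ℝ h x (Pi.single i0 1)
        + ε * lapP h x)) z := by
  unfold lap lapX lapY
  simp only [dX_wave ε k i0 _ hh, dY_wave ε k i0 _ hh, dY_zero,
      dX_wave ε k i0 _ (hh.cder _ _ _ _)]
  unfold wave lapP
  simp only [cder_cder ε k i0 _ hh]
  rw [← Finset.mul_sum, Finset.sum_add_distrib]
  simp only [Finset.sum_ite_eq', Finset.mem_univ, if_true, ← Finset.mul_sum,
    Finset.sum_const_zero]
  ring

lemma exists_test : ∃ g : (Fin d → ℝ) → ℂ, IsTest g ∧ 0 < ∫ x, ‖g x‖^2 := by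
  let f : ContDiffBump (0 : Fin d → ℝ) := ⟨1, 2, one_pos, one_lt_two⟩
  have ht : IsTest (fun x => ((f x : ℝ) : ℂ)) :=
    ⟨Complex.ofRealCLM.contDiff.comp f.contDiff,
      f.hasCompactSupport.comp_left (g := fun x : ℝ => (x : ℂ)) (by simp)⟩
  refine ⟨_, ht, ?_⟩
  refine Continuous.integral_pos_of_hasCompactSupport_nonneg_nonzero (x := 0)
    ?_ ?_ ?_ ?_
  · have := ht.1.continuous; fun_prop
  · exact ht.2.comp_left (g := fun z : ℂ => ‖z‖^2) (by simp)
  · intro x; positivity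
  · have : f 0 = 1 := f.one_of_mem_closedBall (by simp [f])
    simp [this]

lemma muT_pos (n : ℕ) : 0 < (μT n).real univ := by
  unfold μT torusBox
  rw [measureReal_restrict_apply_univ, measureReal_def, Real.volume_pi_Ico]
  simp only [ENNReal.toReal_prod]
  apply Finset.prod_pos
  intro i _
  rw [ENNReal.toReal_ofReal (by simp; positivity)]
  simp; positivity

end helpers3

end BNLS
namespace BNLS

section helpers4

variable {d n : ℕ}

lemma lapP_test {g : (Fin d → ℝ) → ℂ} (hg : IsTest g) : IsTest (lapP g) := by
  have : ∀ s : Finset (Fin d), IsTest (fun x => ∑ i ∈ s,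
      fderiv ℝ (fun y => fderiv ℝ g y (Pi.single i 1)) x (Pi.single i 1)) := by
    intro s
    induction s using Finset.induction_on with
    | empty =>
      simp only [Finset.sum_empty]
      exact ⟨contDiff_const, HasCompactSupport.zero⟩
    | insert i s hi ih =>
      simp only [Finset.sum_insert hi]
      exact ((hg.deriv _).deriv _).add ih
  exact this Finset.univ

lemma fderiv_cmul {g : (Fin d → ℝ) → ℂ} (hg : IsTest g) (a : ℂ) (x v : Fin d → ℝ) :
    fderiv ℝ (fun y => a * g y) x v = a * fderiv ℝ g x v := by
  rw [((hg.1.differentiable (by simp) x).hasFDerivAt.const_mul a).fderiv]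
  simp

lemma lapP_cmul {g : (Fin d → ℝ) → ℂ} (hg : IsTest g) (a : ℂ) (x : Fin d → ℝ) :
    lapP (fun y => a * g y) x = a * lapP g x := by
  unfold lapP
  simp only [fderiv_cmul hg, fderiv_cmul (hg.deriv _), Finset.mul_sum]

lemma exists_energy_lt (i0 : Fin d) {β c δ : ℝ} (hβ : β < 0) (hc : 0 < c) (hδ : 0 < δ) :
    ∃ u : Pt d n → ℂ, InH2 d n u ∧ Mass d n u = c ∧
      lapSq d n u + β * gradSq d n u < -β^2 * c / 4 + δ := by
  obtain ⟨g, hg, hG⟩ := exists_test (d := d)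
  set G := ∫ x, ‖g x‖^2 with hGdef
  have hT := muT_pos n
  set T := (μT n).real univ with hTdef
  set k := Real.sqrt (-β/2) with hk
  have hk2 : k^2 = -β/2 := Real.sq_sqrt (by linarith)
  have t1 : IsTest (fun x => 2 * Complex.I * k * fderiv ℝ g x (Pi.single i0 1)) :=
    (hg.deriv _).const_mul _
  have t2 := lapP_test hg
  set P := ∫ x, ‖2 * Complex.I * k * fderiv ℝ g x (Pi.single i0 1)‖^2 with hP
  set Q := ∫ x, ‖lapP g x‖^2 with hQ
  have hlim : Tendsto (fun ε : ℝ => c / G * (ε^2 * (2 * P + 2 * ε^2 * Q))) (nhdsWithin 0 (Ioi 0))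
      (nhds 0) := by
    have : Continuous (fun ε : ℝ => c / G * (ε^2 * (2 * P + 2 * ε^2 * Q))) := by fun_prop
    have := this.tendsto 0
    simp only [ne_eq, OfNat.ofNat_ne_zero, not_false_eq_true, zero_pow, zero_mul,
      mul_zero] at this
    exact this.mono_left nhdsWithin_le_nhds
  obtain ⟨ε, hlt, hε⟩ := ((hlim.eventually (gt_mem_nhds hδ)).and self_mem_nhdsWithin).exists
  have hε : 0 < ε := hε
  set a := Real.sqrt (c / (T * (ε^d)⁻¹ * G)) with ha
  have ha2 : a^2 = c / (T * (ε^d)⁻¹ * G) := Real.sq_sqrt (by positivity)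
  have hTG : T * (ε^d)⁻¹ * a^2 = c / G := by
    rw [ha2]; field_simp
  have hh : IsTest (fun x => (a:ℂ) * g x) := hg.const_mul _
  have hin := wave_inH2 (n := n) hε k i0 hh
  have hmass : Mass d n (wave n ε k i0 (fun x => (a:ℂ) * g x)) = c := by
    unfold Mass
    rw [wave_integral hε]
    simp only [norm_mul, mul_pow, Complex.norm_real, Real.norm_eq_abs, sq_abs]
    rw [integral_const_mul, ← hGdef, ← hTdef]
    calc T * ((ε^d)⁻¹ * (a^2 * G)) = (T * (ε^d)⁻¹ * a^2) * G := by ring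
      _ = c := by rw [hTG]; field_simp
  refine ⟨_, hin, hmass, ?_⟩
  rw [energy_identity hin, hmass]
  have e1 : ∀ z, lap d n (wave n ε k i0 (fun x => (a:ℂ) * g x)) z
      - ((β/2 : ℝ) : ℂ) * wave n ε k i0 (fun x => (a:ℂ) * g x) z =
      wave n ε k i0 (fun x => ((a * ε : ℝ) : ℂ) *
        (2 * Complex.I * k * fderiv ℝ g x (Pi.single i0 1) + ε * lapP g x)) z := by
    intro z
    have hb : ((β/2 : ℝ) : ℂ) = -(k:ℂ)^2 := by
      rw [← Complex.ofReal_pow, hk2]; push_cast; ring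
    rw [hb, neg_mul, sub_neg_eq_add, lap_wave ε k i0 hh]
    congr 1
    ext x
    rw [fderiv_cmul hg, lapP_cmul hg]
    push_cast
    ring
  simp only [e1]
  rw [wave_integral hε]
  simp only [norm_mul ((a * ε : ℝ) : ℂ), mul_pow |a * ε|, Complex.norm_real,
    Real.norm_eq_abs, sq_abs]
  rw [integral_const_mul]
  have hJ : ∫ x, ‖2 * Complex.I * k * fderiv ℝ g x (Pi.single i0 1) + ε * lapP g x‖^2
      ≤ 2 * P + 2 * ε^2 * Q := by
    rw [hP, hQ, ← integral_const_mul, ← integral_const_mul,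
      ← integral_add (t1.integrable.const_mul _) (t2.integrable.const_mul _)]
    refine integral_mono (t1.add (t2.const_mul (ε : ℂ))).integrable
      ((t1.integrable.const_mul _).add (t2.integrable.const_mul _)) fun x => ?_
    have h1 := norm_add_le (2 * Complex.I * k * fderiv ℝ g x (Pi.single i0 1)) (ε * lapP g x)
    have h2 : ‖(ε : ℂ) * lapP g x‖^2 = ε^2 * ‖lapP g x‖^2 := by
      rw [norm_mul, mul_pow, Complex.norm_real, Real.norm_eq_abs, sq_abs]
    have h3 := pow_le_pow_left₀ (norm_nonneg _) h1 2
    have h4 := add_sq_le (a := ‖2 * Complex.I * k * fderiv ℝ g x (Pi.single i0 1)‖)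
      (b := ‖(ε : ℂ) * lapP g x‖)
    simp only
    rw [h2] at h4
    linarith
  have hfin : T * ((ε^d)⁻¹ * ((a * ε)^2 *
      ∫ x, ‖2 * Complex.I * k * fderiv ℝ g x (Pi.single i0 1) + ε * lapP g x‖^2))
      ≤ c / G * (ε^2 * (2 * P + 2 * ε^2 * Q)) := by
    rw [← hTG]
    calc _ = T * (ε^d)⁻¹ * a^2 * (ε^2 *
        ∫ x, ‖2 * Complex.I * k * fderiv ℝ g x (Pi.single i0 1) + ε * lapP g x‖^2) := by ring
      _ ≤ _ := by gcongr
  linarith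

end helpers4

end BNLS

open BNLS in
/-- `inf {‖Δu‖₂² + β‖∇u‖₂² : u ∈ S(c)} = -β²c/4` for `β < 0`, `c > 0`. -/
theorem stmt_2 (d n : ℕ) (hd : 1 ≤ d) (hn : 1 ≤ n) (β c : ℝ) (hβ : β < 0) (hc : 0 < c) :
    sInf {r : ℝ | ∃ u : Pt d n → ℂ, InH2 d n u ∧ Mass d n u = c ∧
        r = lapSq d n u + β * gradSq d n u} = -β^2 * c / 4 := by
  apply csInf_eq_of_forall_ge_of_forall_gt_exists_lt
  · obtain ⟨u, h1, h2, h3⟩ := exists_energy_lt (n := n) ⟨0, hd⟩ hβ hc one_pos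
    exact ⟨_, u, h1, h2, rfl⟩
  · rintro r ⟨u, h1, h2, rfl⟩
    rw [energy_identity h1, h2]
    have : 0 ≤ ∫ z, ‖lap d n u z - ((β/2 : ℝ) : ℂ) * u z‖^2 ∂(μP d n) :=
      integral_nonneg fun z => by positivity
    linarith
  · intro w hw
    obtain ⟨u, h1, h2, h3⟩ := exists_energy_lt (n := n) ⟨0, hd⟩ hβ hc (sub_pos.2 hw)
    exact ⟨_, ⟨u, h1, h2, rfl⟩, by linarith⟩
end
end

section
/- Let β ∈ ℝ, 0 < α < 8/(d+n), and define E(u) = ½‖Δu‖₂² + (β/2)‖∇u‖₂² - (1/(α+2))‖u‖_{α+2}^{α+2} on H²(ℝ^d×𝕋^n) and m_c = inf{E(u) : ‖u‖₂² = c}. Then m_c > -∞ for every c > 0, and every minimizing sequence for m_c is bounded in H²(ℝ^d×𝕋^n). -/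
noncomputable section

open MeasureTheory Real Filter Set

namespace BNLS

section Aux

set_option linter.unusedSectionVars false

variable {d n : ℕ}

/-- Periodicity with arbitrary codomain. -/
def Per {d n : ℕ} {E : Type*} (u : Pt d n → E) : Prop :=
  ∀ j : Fin n, ∀ p : Pt d n, u (p.1, p.2 + (2*π) • (Pi.single j 1 : Fin n → ℝ)) = u p

/-- Directional derivative. -/
def D {d n : ℕ} {E : Type*} [NormedAddCommGroup E] [NormedSpace ℝ E] (e : Pt d n)
    (u : Pt d n → E) : Pt d n → E := fun p => fderiv ℝ u p e

/-- Translated fundamental domain. -/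
def Sd {d n : ℕ} (e : Pt d n) : Set (Pt d n) :=
  {p | ∀ j, p.2 j ∈ Set.Ico (e.2 j) (e.2 j + 2 * π)}

/-- The lattice homomorphism. -/
def latHom (d n : ℕ) : (Fin n → ℤ) →+ Pt d n where
  toFun k := (0, fun j => k j • (2 * π))
  map_zero' := by ext <;> simp
  map_add' a b := by ext <;> simp [add_mul]

theorem measurableSet_Sd (e : Pt d n) : MeasurableSet (Sd e) := by
  unfold Sd
  rw [Set.ofPred_forall]
  refine MeasurableSet.iInter fun j => ?_
  exact (measurableSet_Ico : MeasurableSet (Set.Ico (e.2 j) (e.2 j + 2 * π))).preimage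
    ((measurable_pi_apply j).comp measurable_snd)

theorem μP_eq : μP d n = (volume : Measure (Pt d n)).restrict (Sd 0) := by
  unfold μP μT
  rw [← Measure.restrict_univ (μ := (volume : Measure (Fin d → ℝ))), Measure.prod_restrict]
  congr 1
  ext p
  simp [Sd, torusBox, Set.mem_pi]

instance : SFinite (μP d n) := by unfold μP μT; infer_instance

instance haarPt : (volume : Measure (Pt d n)).IsAddHaarMeasure := by
  exact Measure.prod.instIsAddHaarMeasure (volume : Measure (Fin d → ℝ)) (volume : Measure (Fin n → ℝ))

instance latInv : VAddInvariantMeasure (latHom d n).range (Pt d n) volume :=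
  ⟨fun c s _ => measure_preimage_add volume (c : Pt d n) s⟩

instance latCount : Countable (latHom d n).range :=
  Set.countable_coe_iff.mpr (by rw [AddMonoidHom.coe_range]; exact Set.countable_range _)

theorem lat_vadd (g : (latHom d n).range) (k : Fin n → ℤ) (h : latHom d n k = g) (x : Pt d n) :
    g +ᵥ x = (x.1, fun j => x.2 j + k j • (2 * π)) := by
  change (g : Pt d n) + x = _
  rw [← h]
  ext <;> simp [latHom, add_comm]

theorem fundDom (e : Pt d n) :
    IsAddFundamentalDomain (latHom d n).range (Sd e) (volume : Measure (Pt d n)) := by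
  refine IsAddFundamentalDomain.mk' (measurableSet_Sd e).nullMeasurableSet fun x => ?_
  have h := fun j => existsUnique_add_zsmul_mem_Ico (by positivity : (0:ℝ) < 2 * π) (x.2 j) (e.2 j)
  choose k hk hk' using h
  refine ⟨⟨latHom d n k, AddMonoidHom.mem_range.2 ⟨k, rfl⟩⟩, ?_, ?_⟩
  · intro j
    have := hk j
    rw [lat_vadd _ k rfl]
    exact this
  · intro g h
    obtain ⟨k', hk2⟩ := AddMonoidHom.mem_range.1 g.2
    apply Subtype.ext
    rw [← hk2]
    congr 1
    ext j
    apply hk' j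
    have := h j
    rw [lat_vadd _ k' hk2] at this
    exact this

theorem Per.zsmul {E : Type*} {u : Pt d n → E} (hu : Per u) (j : Fin n) (k : ℤ) (p : Pt d n) :
    u (p.1, p.2 + k • ((2*π) • (Pi.single j 1 : Fin n → ℝ))) = u p := by
  have hp : Function.Periodic (fun y => u (p.1, y)) ((2*π) • (Pi.single j 1 : Fin n → ℝ)) :=
    fun y => hu j (p.1, y)
  exact hp.zsmul k p.2

theorem Per.lat {E : Type*} {u : Pt d n → E} (hu : Per u) (g : (latHom d n).range) (p : Pt d n) :
    u (g +ᵥ p) = u p := by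
  obtain ⟨k, hk⟩ := AddMonoidHom.mem_range.1 g.2
  have key : ∀ (s : Finset (Fin n)) (p : Pt d n),
      u (p.1, p.2 + ∑ j ∈ s, k j • ((2*π) • (Pi.single j 1 : Fin n → ℝ))) = u p := by
    intro s
    induction s using Finset.induction_on with
    | empty => intro p; simp
    | insert a s ha ih =>
      intro p
      rw [Finset.sum_insert ha, ← add_assoc]
      have := ih (p.1, p.2 + k a • ((2*π) • (Pi.single a 1 : Fin n → ℝ)))
      simp only at this
      rw [this, hu.zsmul]
  rw [← key Finset.univ p, lat_vadd _ k hk]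
  congr 2
  ext j
  simp [Finset.sum_apply, Pi.single_apply, mul_comm]

theorem lint_Sd {g : Pt d n → ENNReal} (hg : Per g) (e : Pt d n) :
    ∫⁻ z in Sd e, g z = ∫⁻ z, g z ∂(μP d n) := by
  rw [μP_eq]
  exact (fundDom e).setLIntegral_eq (fundDom 0) g hg.lat

theorem pre_Sd (e : Pt d n) : (fun z : Pt d n => z + e) ⁻¹' (Sd e) = Sd 0 := by
  ext p
  simp only [Sd, Set.mem_preimage, Set.mem_ofPred_eq, Set.mem_Ico]
  refine forall_congr' fun j => ?_
  simp only [Prod.snd_add, Pi.add_apply, Prod.snd_zero, Pi.zero_apply]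
  constructor <;> rintro ⟨h1, h2⟩ <;> constructor <;> linarith

theorem mp_shift (e : Pt d n) : MeasurePreserving (fun z : Pt d n => z + e) (μP d n)
    (volume.restrict (Sd e)) := by
  rw [μP_eq, ← pre_Sd e]
  exact (measurePreserving_add_right volume e).restrict_preimage (measurableSet_Sd e)

theorem emb_shift (e : Pt d n) : MeasurableEmbedding (fun z : Pt d n => z + e) :=
  (MeasurableEquiv.addRight e).measurableEmbedding

theorem lint_shift {g : Pt d n → ENNReal} (hg : Per g) (e : Pt d n) :
    ∫⁻ z, g (z + e) ∂(μP d n) = ∫⁻ z, g z ∂(μP d n) := by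
  rw [← lint_Sd hg e]
  exact (mp_shift e).lintegral_comp_emb (emb_shift e) g

theorem int_shift {E : Type*} [NormedAddCommGroup E] [NormedSpace ℝ E] {g : Pt d n → E}
    (hg : Per g) (e : Pt d n) :
    ∫ z, g (z + e) ∂(μP d n) = ∫ z, g z ∂(μP d n) := by
  rw [(mp_shift e).integral_comp (emb_shift e) g, μP_eq]
  exact (fundDom e).setIntegral_eq (fundDom 0) hg.lat

theorem integrable_shift {E : Type*} [NormedAddCommGroup E] {g : Pt d n → E}
    (hg : Per g) (hi : Integrable g (μP d n)) (e : Pt d n) :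
    Integrable (fun z => g (z + e)) (μP d n) := by
  have := (mp_shift e).integrable_comp_emb (emb_shift e) (g := g)
  refine this.2 ?_
  rw [μP_eq] at hi
  exact ((fundDom e).integrableOn_iff (fundDom 0) hg.lat).2 hi

theorem Per.shift {E : Type*} {u : Pt d n → E} (hu : Per u) (e : Pt d n) :
    Per (fun z => u (z + e)) := by
  intro j p
  have := hu j (p + e)
  simp only [Prod.fst_add, Prod.snd_add] at this
  change u _ = u (p + e)
  rw [← this]
  congr 1
  ext <;> simp <;> ring

theorem Per.comp {E F : Type*} {u : Pt d n → E} (hu : Per u) (φ : E → F) :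
    Per (fun z => φ (u z)) := fun j p => by simp only [hu j p]

theorem Per.comp2 {E F G : Type*} {u : Pt d n → E} {v : Pt d n → F} (hu : Per u) (hv : Per v)
    (φ : E → F → G) : Per (fun z => φ (u z) (v z)) := fun j p => by simp only [hu j p, hv j p]

variable {E : Type*} [NormedAddCommGroup E] [NormedSpace ℝ E]

theorem D_shift (e f : Pt d n) (u : Pt d n → E) :
    D e (fun z => u (z + f)) = fun z => D e u (z + f) := by
  ext p
  simp only [D]
  rw [fderiv_comp_add_right]

theorem Per.D {u : Pt d n → E} (hu : Per u) (e : Pt d n) : Per (D e u) := by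
  intro j p
  have h : (fun z => u (z + (0, (2*π) • (Pi.single j 1 : Fin n → ℝ)))) = u := by
    ext z
    have := hu j z
    rw [← this]
    congr 1
    ext <;> simp
  have h2 := congrFun (D_shift e (0, (2*π) • (Pi.single j 1 : Fin n → ℝ)) u) p
  rw [h] at h2
  rw [h2]
  congr 1
  ext <;> simp

theorem slab_integrable {g : Pt d n → E} (hg : Per g) (hc : Continuous g)
    (hi : Integrable g (μP d n)) (e : Pt d n) :
    Integrable (Function.uncurry fun (z : Pt d n) (s : ℝ) => g (z + s • e))
      ((μP d n).prod (volume.restrict (Set.Ioc (0:ℝ) 1))) := by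
  rw [integrable_prod_iff']
  · refine ⟨Eventually.of_forall fun s => integrable_shift hg hi (s • e), ?_⟩
    have : (fun s : ℝ => ∫ z, ‖Function.uncurry (fun (z : Pt d n) (s : ℝ) => g (z + s • e)) (z, s)‖
        ∂(μP d n)) = fun _ => ∫ z, ‖g z‖ ∂(μP d n) := by
      ext s
      exact int_shift (hg.comp fun x => ‖x‖) (s • e)
    rw [this]
    exact integrable_const _
  · have hcc : Continuous (Function.uncurry fun (z : Pt d n) (s : ℝ) => g (z + s • e)) := by
      unfold Function.uncurry; fun_prop
    exact hcc.aestronglyMeasurable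

theorem slab_integral [CompleteSpace E] {g : Pt d n → E} (hg : Per g) (hc : Continuous g)
    (hi : Integrable g (μP d n)) (e : Pt d n) :
    ∫ z, (∫ s in Set.Ioc (0:ℝ) 1, g (z + s • e)) ∂(μP d n) = ∫ z, g z ∂(μP d n) := by
  rw [integral_integral_swap (slab_integrable hg hc hi e)]
  have : ∀ s : ℝ, ∫ z, g (z + s • e) ∂(μP d n) = ∫ z, g z ∂(μP d n) :=
    fun s => int_shift hg (s • e)
  simp_rw [this]
  rw [integral_const]
  simp

theorem ftc [CompleteSpace E] {u : Pt d n → E} (hu : ContDiff ℝ 1 u) (e z : Pt d n) :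
    ∫ s in Set.Ioc (0:ℝ) 1, D e u (z + s • e) = u (z + e) - u z := by
  rw [← intervalIntegral.integral_of_le zero_le_one]
  have := intervalIntegral.integral_eq_sub_of_hasDerivAt (a := 0) (b := 1)
    (f := fun s : ℝ => u (z + s • e)) (f' := fun s => D e u (z + s • e)) ?_ ?_
  · simpa using this
  · intro s _
    have h1 : HasFDerivAt u (fderiv ℝ u (z + s • e)) (z + s • e) :=
      (hu.differentiable one_ne_zero _).hasFDerivAt
    have h2 : HasDerivAt (fun s : ℝ => z + s • e) e s := by
      simpa using ((hasDerivAt_id s).smul_const e).const_add z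
    exact h1.comp_hasDerivAt s h2
  · apply Continuous.intervalIntegrable
    have := hu.continuous_fderiv one_ne_zero
    unfold D
    fun_prop

theorem cont_D {u : Pt d n → E} (hu : ContDiff ℝ 1 u) (e : Pt d n) : Continuous (D e u) := by
  have := hu.continuous_fderiv one_ne_zero
  unfold D
  fun_prop

theorem contDiff_D {u : Pt d n → E} (hu : ContDiff ℝ 2 u) (e : Pt d n) : ContDiff ℝ 1 (D e u) := by
  have := hu.fderiv_right (m := 1) (by norm_num)
  unfold D
  fun_prop

/-- Integral of a derivative vanishes. -/
theorem int_D_zero [CompleteSpace E] {f : Pt d n → E} (hf : ContDiff ℝ 1 f) (hp : Per f)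
    (hi : Integrable f (μP d n)) (e : Pt d n) (hi' : Integrable (D e f) (μP d n)) :
    ∫ z, D e f z ∂(μP d n) = 0 := by
  rw [← slab_integral (hp.D e) (cont_D hf e) hi' e]
  simp_rw [ftc hf]
  rw [integral_sub (integrable_shift hp hi e) hi, int_shift hp, sub_self]

/-- Square integrability. -/
def L2 {d n : ℕ} {E : Type*} [NormedAddCommGroup E] (f : Pt d n → E) : Prop :=
  Continuous f ∧ Per f ∧ Integrable (fun z => ‖f z‖ ^ 2) (μP d n)

theorem L2.shift {f : Pt d n → E} (hf : L2 f) (e : Pt d n) : L2 (fun z => f (z + e)) :=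
  ⟨by have := hf.1; fun_prop, hf.2.1.shift e,
    integrable_shift (hf.2.1.comp fun x => ‖x‖ ^ 2) hf.2.2 e⟩

theorem L2.shift_int {f : Pt d n → E} (hf : L2 f) (e : Pt d n) :
    ∫ z, ‖f (z + e)‖ ^ 2 ∂(μP d n) = ∫ z, ‖f z‖ ^ 2 ∂(μP d n) :=
  int_shift (hf.2.1.comp fun x => ‖x‖ ^ 2) e

theorem L2.add {f g : Pt d n → E} (hf : L2 f) (hg : L2 g) : L2 (fun z => f z + g z) := by
  refine ⟨hf.1.add hg.1, hf.2.1.comp2 hg.2.1 (· + ·), ?_⟩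
  refine ((hf.2.2.add hg.2.2).const_mul 2).mono'
    ((hf.1.add hg.1).norm.pow 2).aestronglyMeasurable (Eventually.of_forall fun z => ?_)
  simp only [Pi.add_apply, norm_pow, norm_norm]
  have := norm_add_le (f z) (g z)
  have h0 := norm_nonneg (f z + g z)
  nlinarith [sq_nonneg (‖f z‖ - ‖g z‖)]

theorem L2.neg {f : Pt d n → E} (hf : L2 f) : L2 (fun z => - f z) :=
  ⟨hf.1.neg, hf.2.1.comp Neg.neg, by simpa using hf.2.2⟩

theorem L2.sub {f g : Pt d n → E} (hf : L2 f) (hg : L2 g) : L2 (fun z => f z - g z) := by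
  simpa [sub_eq_add_neg] using hf.add hg.neg

theorem L2.sum {ι : Type*} (s : Finset ι) {f : ι → Pt d n → E} (hf : ∀ i ∈ s, L2 (f i)) :
    L2 (fun z => ∑ i ∈ s, f i z) := by
  classical
  induction s using Finset.induction_on with
  | empty => exact ⟨by simpa using continuous_const, fun j p => by simp, by simp⟩
  | insert a s ha ih =>
    simp only [Finset.sum_insert ha]
    exact (hf a (by simp)).add (ih fun i hi => hf i (by simp [hi]))

theorem L2.inner {f g : Pt d n → ℂ} (hf : L2 f) (hg : L2 g) :
    Integrable (fun z => inner ℝ (f z) (g z)) (μP d n) := by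
  refine (hf.2.2.add hg.2.2).mono' (hf.1.inner hg.1).aestronglyMeasurable
    (Eventually.of_forall fun z => ?_)
  have := norm_inner_le_norm (𝕜 := ℝ) (f z) (g z)
  simp only [Pi.add_apply]
  nlinarith [sq_nonneg (‖f z‖ - ‖g z‖), sq_nonneg (‖f z‖), sq_nonneg (‖g z‖)]

/-- L² bound of the difference. -/
theorem diff_bound [CompleteSpace E] {w : Pt d n → E} (hw : ContDiff ℝ 1 w) (h1 : L2 w)
    (e : Pt d n) (h2 : L2 (D e w)) :
    ∫ z, ‖w (z + e) - w z‖ ^ 2 ∂(μP d n) ≤ ∫ z, ‖D e w z‖ ^ 2 ∂(μP d n) := by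
  have hp := h2.2.1.comp fun x => ‖x‖ ^ 2
  have hcc : Continuous (fun z => ‖D e w z‖ ^ 2) := h2.1.norm.pow 2
  rw [← slab_integral hp hcc h2.2.2 e]
  refine integral_mono ((h1.shift e).sub h1).2.2
    (slab_integrable hp hcc h2.2.2 e).integral_prod_left fun z => ?_
  simp only
  rw [← ftc hw]
  have hcs : Continuous fun s : ℝ => D e w (z + s • e) := by have := h2.1; fun_prop
  have hconv : ConvexOn ℝ Set.univ fun x : E => ‖x‖ ^ 2 :=
    (convexOn_univ_norm).pow (fun _ _ => norm_nonneg _) 2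
  have : IsProbabilityMeasure (volume.restrict (Set.Ioc (0:ℝ) 1)) := ⟨by simp⟩
  have := hconv.map_integral_le (μ := volume.restrict (Set.Ioc (0:ℝ) 1))
    (f := fun s => D e w (z + s • e)) (by fun_prop) isClosed_univ (by simp)
    (hcs.integrableOn_Ioc) ((hcs.norm.pow 2).integrableOn_Ioc)
  exact this

end Aux

end BNLS
namespace BNLS

section Aux2

set_option linter.unusedSectionVars false

variable {d n : ℕ}

/-- Coordinate directions. -/
def ev {d n : ℕ} : Fin d ⊕ Fin n → Pt d n :=
  Sum.elim (fun i => (Pi.single i 1, 0)) (fun j => (0, Pi.single j 1))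

/-- Coordinates. -/
def co {d n : ℕ} (e : Pt d n) : Fin d ⊕ Fin n → ℝ := Sum.elim e.1 e.2

theorem sum_co (e : Pt d n) : e = ∑ a, co e a • ev a := by
  rw [Fintype.sum_sum_type]
  ext i
  · simp [co, ev, Finset.sum_apply, Prod.fst_sum, Pi.single_apply]
  · simp [co, ev, Finset.sum_apply, Prod.snd_sum, Pi.single_apply]

theorem co_le (e : Pt d n) (a : Fin d ⊕ Fin n) : |co e a| ≤ ‖e‖ := by
  rcases a with i | j
  · exact (norm_le_pi_norm e.1 i).trans (norm_fst_le e)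
  · exact (norm_le_pi_norm e.2 j).trans (norm_snd_le e)

theorem D_co (e : Pt d n) (u : Pt d n → ℂ) (z : Pt d n) :
    D e u z = ∑ a, co e a • D (ev a) u z := by
  unfold D
  conv_lhs => rw [sum_co e]
  rw [map_sum]
  simp

theorem D_D {u : Pt d n → ℂ} (hu : ContDiff ℝ 2 u) (e f z : Pt d n) :
    D e (D f u) z = fderiv ℝ (fderiv ℝ u) z e f := by
  have h1 : DifferentiableAt ℝ (fderiv ℝ u) z :=
    (hu.fderiv_right (m := 1) (by norm_num)).differentiable one_ne_zero z
  unfold D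
  rw [fderiv_clm_apply h1 (by fun_prop)]
  simp

theorem D_symm {u : Pt d n → ℂ} (hu : ContDiff ℝ 2 u) (e f : Pt d n) :
    D e (D f u) = D f (D e u) := by
  ext z
  rw [D_D hu, D_D hu]
  exact (hu.contDiffAt.isSymmSndFDerivAt (by simp)).eq e f

theorem DD_co {u : Pt d n → ℂ} (hu : ContDiff ℝ 2 u) (e f z : Pt d n) :
    D e (D f u) z = ∑ a, ∑ b, (co e a * co f b) • D (ev a) (D (ev b) u) z := by
  rw [D_co]
  refine Finset.sum_congr rfl fun a _ => ?_
  rw [D_symm hu, D_co, Finset.smul_sum]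
  refine Finset.sum_congr rfl fun b _ => ?_
  rw [smul_smul, D_symm hu]

/-- The class of functions used. -/
structure G2 {d n : ℕ} (u : Pt d n → ℂ) : Prop where
  cd : ContDiff ℝ 2 u
  l0 : L2 u
  l1 : ∀ a, L2 (D (ev a) u)
  l2 : ∀ a b, L2 (D (ev a) (D (ev b) u))

theorem L2.smul {f : Pt d n → ℂ} (hf : L2 f) (c : ℝ) : L2 (fun z => c • f z) :=
  ⟨hf.1.const_smul c, hf.2.1.comp (c • ·), by
    simp only [norm_smul, mul_pow]; exact hf.2.2.const_mul _⟩

theorem G2.D1 {u : Pt d n → ℂ} (hu : G2 u) (e : Pt d n) : L2 (D e u) := by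
  have : D e u = fun z => ∑ a, co e a • D (ev a) u z := funext (D_co e u)
  rw [this]
  exact L2.sum _ fun a _ => (hu.l1 a).smul _

theorem G2.D2 {u : Pt d n → ℂ} (hu : G2 u) (e f : Pt d n) : L2 (D e (D f u)) := by
  have : D e (D f u) = fun z => ∑ a, ∑ b, (co e a * co f b) • D (ev a) (D (ev b) u) z :=
    funext (DD_co hu.cd e f)
  rw [this]
  exact L2.sum _ fun a _ => L2.sum _ fun b _ => (hu.l2 a b).smul _

theorem D_sub {u v : Pt d n → ℂ} (hu : ContDiff ℝ 1 u) (hv : ContDiff ℝ 1 v) (e : Pt d n) :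
    D e (fun z => u z - v z) = fun z => D e u z - D e v z := by
  ext z
  unfold D
  rw [fderiv_fun_sub (hu.differentiable one_ne_zero z) (hv.differentiable one_ne_zero z)]
  rfl

theorem G2.shift {u : Pt d n → ℂ} (hu : G2 u) (e : Pt d n) : G2 (fun z => u (z + e)) := by
  refine ⟨by have := hu.cd; fun_prop, hu.l0.shift e, fun a => ?_, fun a b => ?_⟩
  · rw [D_shift]; exact (hu.l1 a).shift e
  · rw [D_shift, D_shift]; exact (hu.l2 a b).shift e

theorem G2.c1 {u : Pt d n → ℂ} (hu : G2 u) : ContDiff ℝ 1 u := hu.cd.of_le (by norm_num)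

theorem G2.sub {u v : Pt d n → ℂ} (hu : G2 u) (hv : G2 v) : G2 (fun z => u z - v z) := by
  refine ⟨hu.cd.sub hv.cd, hu.l0.sub hv.l0, fun a => ?_, fun a b => ?_⟩
  · rw [D_sub hu.c1 hv.c1]; exact (hu.l1 a).sub (hv.l1 a)
  · rw [D_sub hu.c1 hv.c1, D_sub (contDiff_D hu.cd _) (contDiff_D hv.cd _)]
    exact (hu.l2 a b).sub (hv.l2 a b)

/-- Laplacian. -/
def Lap {d n : ℕ} (u : Pt d n → ℂ) : Pt d n → ℂ := fun z => ∑ a, D (ev a) (D (ev a) u) z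

theorem G2.lap {u : Pt d n → ℂ} (hu : G2 u) : L2 (Lap u) := L2.sum _ fun a _ => hu.l2 a a

theorem green {v : Pt d n → ℂ} (hv : G2 v) :
    ∑ a, ∫ z, ‖D (ev a) v z‖ ^ 2 ∂(μP d n) = - ∫ z, inner ℝ (Lap v z) (v z) ∂(μP d n) := by
  have key : ∀ a, ∫ z, ‖D (ev a) v z‖ ^ 2 ∂(μP d n) =
      - ∫ z, inner ℝ (D (ev a) (D (ev a) v) z) (v z) ∂(μP d n) := by
    intro a
    have hD := contDiff_D hv.cd (ev a)
    have hcd : ContDiff ℝ 1 (fun z => inner ℝ (D (ev a) v z) (v z)) := hD.inner ℝ hv.c1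
    have hder : D (ev a) (fun z => inner ℝ (D (ev a) v z) (v z)) =
        fun z => ‖D (ev a) v z‖ ^ 2 + inner ℝ (D (ev a) (D (ev a) v) z) (v z) := by
      ext z
      have := fderiv_inner_apply ℝ (hD.differentiable one_ne_zero z)
        (hv.c1.differentiable one_ne_zero z) (ev a)
      rw [← real_inner_self_eq_norm_sq]
      exact this
    have hI2 := (hv.l2 a a).inner hv.l0
    have := int_D_zero hcd ((hv.l1 a).2.1.comp2 hv.l0.2.1 fun x y => inner ℝ x y)
      ((hv.l1 a).inner hv.l0) (ev a) (by rw [hder]; exact (hv.l1 a).2.2.add hI2)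
    rw [hder, integral_add (hv.l1 a).2.2 hI2] at this
    linarith
  simp_rw [key]
  rw [Finset.sum_neg_distrib, ← integral_finsetSum _ fun a _ => (hv.l2 a a).inner hv.l0]
  congr 2
  ext z
  rw [Lap, sum_inner]

theorem inner_young (x y : ℂ) {t : ℝ} (ht : 0 < t) :
    |inner ℝ x y| ≤ 1/2 * (t * ‖x‖ ^ 2 + t⁻¹ * ‖y‖ ^ 2) := by
  have h := norm_inner_le_norm (𝕜 := ℝ) x y
  rw [Real.norm_eq_abs] at h
  refine h.trans ?_
  have h2 : t * ‖x‖ ^ 2 + t⁻¹ * ‖y‖ ^ 2 - 2 * (‖x‖ * ‖y‖) = t⁻¹ * (t * ‖x‖ - ‖y‖) ^ 2 := by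
    field_simp
    ring
  have : 0 ≤ t⁻¹ * (t * ‖x‖ - ‖y‖) ^ 2 := by positivity
  linarith

theorem int_young {f g : Pt d n → ℂ} (hf : L2 f) (hg : L2 g) {t : ℝ} (ht : 0 < t) :
    |∫ z, inner ℝ (f z) (g z) ∂(μP d n)| ≤
      1/2 * (t * ∫ z, ‖f z‖ ^ 2 ∂(μP d n) + t⁻¹ * ∫ z, ‖g z‖ ^ 2 ∂(μP d n)) := by
  refine abs_integral_le_integral_abs.trans ?_
  rw [← integral_const_mul, ← integral_const_mul,
    ← integral_add (hf.2.2.const_mul _) (hg.2.2.const_mul _), ← integral_const_mul]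
  exact integral_mono (hf.inner hg).abs
    (((hf.2.2.const_mul _).add (hg.2.2.const_mul _)).const_mul _) fun z => inner_young _ _ ht

theorem grad_le {u : Pt d n → ℂ} (hu : G2 u) {t : ℝ} (ht : 0 < t) :
    ∑ a, ∫ z, ‖D (ev a) u z‖ ^ 2 ∂(μP d n) ≤
      1/2 * (t * ∫ z, ‖Lap u z‖ ^ 2 ∂(μP d n) + t⁻¹ * ∫ z, ‖u z‖ ^ 2 ∂(μP d n)) := by
  rw [green hu]
  exact (neg_le_abs _).trans (int_young hu.lap hu.l0 ht)

theorem L2.sd {u : Pt d n → ℂ} (hu : L2 u) (e : Pt d n) :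
    L2 (fun z => (u (z + e) - u z) - (u z - u (z - e))) := by
  have := ((hu.shift e).sub hu).sub (hu.sub (hu.shift (-e)))
  simpa [sub_eq_add_neg] using this

/-- Second difference bound. -/
theorem sd_bound {u : Pt d n → ℂ} (hu : G2 u) (e : Pt d n) :
    ∫ z, ‖(u (z + e) - u z) - (u z - u (z - e))‖ ^ 2 ∂(μP d n) ≤
      ∫ z, ‖D e (D e u) z‖ ^ 2 ∂(μP d n) := by
  have hw : G2 (fun z => u z - u (z + -e)) := hu.sub (hu.shift (-e))
  have h1 := diff_bound hw.c1 hw.l0 e (hw.D1 e)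
  have h2 := diff_bound (contDiff_D hu.cd e) (hu.D1 e) e (hu.D2 e e)
  rw [D_sub hu.c1 (hu.shift (-e)).c1, D_shift] at h1
  have h3 : ∫ z, ‖D e u z - D e u (z + -e)‖ ^ 2 ∂(μP d n) =
      ∫ z, ‖D e u (z + e) - D e u z‖ ^ 2 ∂(μP d n) := by
    rw [← int_shift (g := fun z => ‖D e u z - D e u (z + -e)‖ ^ 2)
      (((hu.D1 e).sub ((hu.D1 e).shift (-e))).2.1.comp fun x => ‖x‖ ^ 2) e]
    simp
  rw [h3] at h1
  simp only [← sub_eq_add_neg, add_sub_cancel_right] at h1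
  exact h1.trans h2

theorem D_smul (c : ℝ) (e : Pt d n) (u : Pt d n → ℂ) : D (c • e) u = fun z => c • D e u z := by
  ext z; simp [D]

theorem Lap_sub_shift {u : Pt d n → ℂ} (hu : G2 u) (e : Pt d n) :
    Lap (fun z => u (z + e) - u z) = fun z => Lap u (z + e) - Lap u z := by
  ext z
  unfold Lap
  rw [← Finset.sum_sub_distrib]
  refine Finset.sum_congr rfl fun a _ => ?_
  rw [D_sub (hu.shift e).c1 hu.c1, D_sub (contDiff_D (hu.shift e).cd _) (contDiff_D hu.cd _),
    D_shift, D_shift]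

theorem diff_grad {u : Pt d n → ℂ} (hu : G2 u) (e : Pt d n) {t : ℝ} (ht : 0 < t) :
    ∑ a, ∫ z, ‖D (ev a) u (z + e) - D (ev a) u z‖ ^ 2 ∂(μP d n) ≤
      1/2 * (t * ∫ z, ‖Lap u z‖ ^ 2 ∂(μP d n) + t⁻¹ * ∫ z, ‖D e (D e u) z‖ ^ 2 ∂(μP d n)) := by
  have hv := (hu.shift e).sub hu
  have hg := green hv
  rw [Lap_sub_shift hu] at hg
  have e1 : ∀ a, D (ev a) (fun z => u (z + e) - u z) =
      fun z => D (ev a) u (z + e) - D (ev a) u z := fun a => by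
    rw [D_sub (hu.shift e).c1 hu.c1, D_shift]
  simp_rw [e1] at hg
  rw [hg]
  have hl := hu.lap
  have hb : L2 (fun z => u z - u (z + -e)) := (hu.sub (hu.shift (-e))).l0
  have h1 : ∫ z, inner ℝ (Lap u (z + e) - Lap u z) (u (z + e) - u z) ∂(μP d n) =
      - ∫ z, inner ℝ (Lap u z) ((u (z + e) - u z) - (u z - u (z - e))) ∂(μP d n) := by
    have h2 := int_shift (g := fun z => inner ℝ (Lap u z) (u z - u (z + -e)))
      (hl.2.1.comp2 hb.2.1 fun x y => inner ℝ x y) e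
    simp only [add_neg_cancel_right] at h2
    simp_rw [inner_sub_left]
    rw [integral_sub ((hl.shift e).inner hv.l0) (hl.inner hv.l0), h2]
    simp_rw [inner_sub_right (Lap u _) (u (_ + e) - u _)]
    simp only [← sub_eq_add_neg] at hb ⊢
    rw [integral_sub (hl.inner hv.l0) (hl.inner hb)]
    ring
  rw [h1, neg_neg]
  refine (le_abs_self _).trans ((int_young hl (hu.l0.sd e) ht).trans ?_)
  have := sd_bound hu e
  gcongr

theorem fatou {f : ℕ → Pt d n → ℝ} {g : Pt d n → ℝ} {B : ℝ} (hf : ∀ k, Continuous (f k))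
    (hf0 : ∀ k z, 0 ≤ f k z) (hfi : ∀ k, Integrable (f k) (μP d n))
    (hg : Integrable g (μP d n)) (hB : ∀ k, ∫ z, f k z ∂(μP d n) ≤ B)
    (ht : ∀ z, Tendsto (fun k => f k z) atTop (nhds (g z))) :
    ∫ z, g z ∂(μP d n) ≤ B := by
  have hg0 : ∀ z, 0 ≤ g z := fun z => ge_of_tendsto' (ht z) fun k => hf0 k z
  have hB0 : 0 ≤ B := (integral_nonneg (hf0 0)).trans (hB 0)
  rw [← ENNReal.ofReal_le_ofReal_iff hB0,
    ofReal_integral_eq_lintegral_ofReal hg (Eventually.of_forall hg0)]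
  have h1 := lintegral_liminf_le (μ := μP d n) (u := atTop)
    (f := fun k z => ENNReal.ofReal (f k z)) fun k => (hf k).measurable.ennreal_ofReal
  have h2 : ∀ z, liminf (fun k => ENNReal.ofReal (f k z)) atTop = ENNReal.ofReal (g z) := fun z =>
    ((ENNReal.continuous_ofReal.tendsto _).comp (ht z)).liminf_eq
  simp_rw [h2] at h1
  refine h1.trans ?_
  refine liminf_le_of_frequently_le' (Frequently.of_forall fun k => ?_)
  rw [← ofReal_integral_eq_lintegral_ofReal (hfi k) (Eventually.of_forall (hf0 k))]
  exact ENNReal.ofReal_le_ofReal (hB k)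

theorem hess_dir {u : Pt d n → ℂ} (hu : G2 u) (e : Pt d n) :
    ∑ a, ∫ z, ‖D e (D (ev a) u) z‖ ^ 2 ∂(μP d n) ≤
      1/2 * (∫ z, ‖Lap u z‖ ^ 2 ∂(μP d n) + ∫ z, ‖D e (D e u) z‖ ^ 2 ∂(μP d n)) := by
  rw [← integral_finsetSum _ fun a _ => (hu.D2 e (ev a)).2.2]
  have hL : ∀ (k : ℕ) a, L2 (fun z => ((k:ℝ) + 1) •
      (D (ev a) u (z + ((k:ℝ) + 1)⁻¹ • e) - D (ev a) u z)) := fun k a =>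
    (((hu.l1 a).shift _).sub (hu.l1 a)).smul _
  refine fatou (f := fun k z => ∑ a, ‖((k:ℝ) + 1) •
    (D (ev a) u (z + ((k:ℝ) + 1)⁻¹ • e) - D (ev a) u z)‖ ^ 2) ?_ ?_ ?_ ?_ ?_ ?_
  · intro k
    exact continuous_finsetSum _ fun a _ => (hL k a).1.norm.pow 2
  · intro k z
    positivity
  · intro k
    exact integrable_finsetSum _ fun a _ => (hL k a).2.2
  · exact integrable_finsetSum _ fun a _ => (hu.D2 e (ev a)).2.2
  · intro k
    rw [integral_finsetSum _ fun a _ => (hL k a).2.2]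
    have hk : (0:ℝ) < (k:ℝ) + 1 := by positivity
    have h := diff_grad hu (((k:ℝ) + 1)⁻¹ • e) (t := (((k:ℝ) + 1)⁻¹) ^ 2) (by positivity)
    have h' := mul_le_mul_of_nonneg_left h (sq_nonneg ((k:ℝ) + 1))
    simp_rw [norm_smul, mul_pow, integral_const_mul]
    rw [← Finset.mul_sum]
    have e1 : D (((k:ℝ) + 1)⁻¹ • e) (D (((k:ℝ) + 1)⁻¹ • e) u) =
        fun z => (((k:ℝ) + 1)⁻¹ ^ 2) • D e (D e u) z := by
      ext z
      simp only [D_smul]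
      have : D e (fun z => ((k:ℝ) + 1)⁻¹ • D e u z) z = ((k:ℝ) + 1)⁻¹ • D e (D e u) z := by
        have hd := (contDiff_D hu.cd e).differentiable one_ne_zero z
        conv_lhs => unfold D
        have := fderiv_fun_const_smul hd (((k:ℝ) + 1)⁻¹)
        rw [show (fun z => ((k:ℝ) + 1)⁻¹ • fderiv ℝ u z e) = fun z => ((k:ℝ) + 1)⁻¹ • D e u z
          from rfl, this]
        rfl
      rw [this, smul_smul, sq]
    rw [e1] at h'
    simp_rw [norm_smul, mul_pow, integral_const_mul] at h'
    rw [Real.norm_of_nonneg hk.le]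
    refine h'.trans (le_of_eq ?_)
    rw [norm_pow, Real.norm_of_nonneg (inv_nonneg.2 hk.le)]
    field_simp
  · intro z
    refine tendsto_finsetSum _ fun a _ => ?_
    refine Tendsto.pow (Tendsto.norm ?_) 2
    have hd : HasFDerivAt (D (ev a) u) (fderiv ℝ (D (ev a) u) z) z :=
      ((contDiff_D hu.cd (ev a)).differentiable one_ne_zero z).hasFDerivAt
    have hd2 : HasDerivAt (fun s : ℝ => D (ev a) u (z + s • e)) (D e (D (ev a) u) z) 0 := by
      have h2 : HasDerivAt (fun s : ℝ => z + s • e) e 0 := by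
        simpa using ((hasDerivAt_id (0:ℝ)).smul_const e).const_add z
      refine HasFDerivAt.comp_hasDerivAt (0:ℝ) (?_ : HasFDerivAt (D (ev a) u) (fderiv ℝ (D (ev a) u) z) _) h2
      simpa using hd
    have hs := hd2.tendsto_slope_zero
    have hseq : Tendsto (fun k : ℕ => ((k:ℝ) + 1)⁻¹) atTop (nhdsWithin 0 {0}ᶜ) := by
      refine tendsto_nhdsWithin_iff.2 ⟨?_, Eventually.of_forall fun k => ?_⟩
      · simpa [one_div] using tendsto_one_div_add_atTop_nhds_zero_nat (𝕜 := ℝ)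
      · have : ((k:ℝ) + 1)⁻¹ ≠ 0 := by positivity
        simpa using this
    have := hs.comp hseq
    refine this.congr fun k => ?_
    simp

/-- Hessian bound by the Laplacian. -/
theorem hess_le {u : Pt d n → ℂ} (hu : G2 u) :
    ∑ b, ∑ a, ∫ z, ‖D (ev b) (D (ev a) u) z‖ ^ 2 ∂(μP d n) ≤
      (d + n : ℝ) * ∫ z, ‖Lap u z‖ ^ 2 ∂(μP d n) := by
  have h1 := Finset.sum_le_sum fun b (_ : b ∈ Finset.univ) => hess_dir hu (ev b)
  have h2 : ∑ b, ∫ z, ‖D (ev b) (D (ev b) u) z‖ ^ 2 ∂(μP d n) ≤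
      ∑ b, ∑ a, ∫ z, ‖D (ev b) (D (ev a) u) z‖ ^ 2 ∂(μP d n) :=
    Finset.sum_le_sum fun b _ => Finset.single_le_sum
      (f := fun a => ∫ z, ‖D (ev b) (D (ev a) u) z‖ ^ 2 ∂(μP d n))
      (fun a _ => integral_nonneg fun z => by positivity) (Finset.mem_univ b)
  rw [← Finset.mul_sum, Finset.sum_add_distrib] at h1
  simp only [Finset.sum_const, Finset.card_univ, Fintype.card_sum, Fintype.card_fin,
    nsmul_eq_mul, Nat.cast_add] at h1
  linarith

end Aux2

end BNLS
namespace BNLS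

section Aux3

variable {d n : ℕ}

/-- Total Hessian. -/
def Hs {d n : ℕ} (u : Pt d n → ℂ) : ℝ :=
  ∑ b, ∑ a, ∫ z, ‖D (ev b) (D (ev a) u) z‖ ^ 2 ∂(μP d n)

theorem Hs_nonneg (u : Pt d n → ℂ) : 0 ≤ Hs u :=
  Finset.sum_nonneg fun _ _ => Finset.sum_nonneg fun _ _ => integral_nonneg fun _ => by positivity

theorem DD_bound {u : Pt d n → ℂ} (hu : G2 u) {e : Pt d n} {r : ℝ} (hr : 0 ≤ r) (he : ‖e‖ ≤ r) :
    ∫ z, ‖D e (D e u) z‖ ^ 2 ∂(μP d n) ≤ (d + n : ℝ) ^ 2 * r ^ 4 * Hs u := by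
  have hpt : ∀ z, ‖D e (D e u) z‖ ^ 2 ≤
      (d + n : ℝ) ^ 2 * r ^ 4 * ∑ b, ∑ a, ‖D (ev b) (D (ev a) u) z‖ ^ 2 := by
    intro z
    have h1 : ‖D e (D e u) z‖ ≤ ∑ x : (Fin d ⊕ Fin n) × (Fin d ⊕ Fin n),
        r ^ 2 * ‖D (ev x.1) (D (ev x.2) u) z‖ := by
      rw [DD_co hu.cd, ← Fintype.sum_prod_type']
      refine (norm_sum_le _ _).trans (Finset.sum_le_sum fun x _ => ?_)
      rw [norm_smul, Real.norm_eq_abs, abs_mul, sq]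
      have := (co_le e x.1).trans he
      have := (co_le e x.2).trans he
      gcongr
    have h2 : ‖D e (D e u) z‖ ^ 2 ≤ (∑ x : (Fin d ⊕ Fin n) × (Fin d ⊕ Fin n),
        r ^ 2 * ‖D (ev x.1) (D (ev x.2) u) z‖) ^ 2 := by gcongr
    refine h2.trans (sq_sum_le_card_mul_sum_sq.trans (le_of_eq ?_))
    simp only [Finset.card_univ, Fintype.card_prod, Fintype.card_sum, Fintype.card_fin, mul_pow]
    rw [← Finset.mul_sum,
      Fintype.sum_prod_type (f := fun x => ‖D (ev x.1) (D (ev x.2) u) z‖ ^ 2)]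
    push_cast
    ring
  have hI : ∀ b, Integrable (fun z => ∑ a, ‖D (ev b) (D (ev a) u) z‖ ^ 2) (μP d n) := fun b =>
    integrable_finsetSum _ fun a _ => (hu.l2 b a).2.2
  refine (integral_mono (hu.D2 e e).2.2
    ((integrable_finsetSum _ fun b _ => hI b).const_mul _) hpt).trans (le_of_eq ?_)
  rw [integral_const_mul, integral_finsetSum _ fun b _ => hI b]
  congr 1
  refine Finset.sum_congr rfl fun b _ => ?_
  rw [integral_finsetSum _ fun a _ => (hu.l2 b a).2.2]

theorem ball_lint {g : Pt d n → ENNReal} (hg : Per g) {r : ℝ} (hr : r ≤ 1) (z : Pt d n) :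
    ∫⁻ ξ in Metric.closedBall (0 : Pt d n) r, g (z + ξ) ≤ ∫⁻ z, g z ∂(μP d n) := by
  have hsub : Metric.closedBall (0 : Pt d n) r ⊆ Sd (0, fun _ => -π) := by
    intro ξ hξ j
    rw [mem_closedBall_zero_iff] at hξ
    have h1 : |ξ.2 j| ≤ 1 := (norm_le_pi_norm ξ.2 j).trans ((norm_snd_le ξ).trans (hξ.trans hr))
    have := abs_le.1 h1
    have := Real.pi_gt_three
    constructor <;> simp <;> linarith
  calc ∫⁻ ξ in Metric.closedBall (0 : Pt d n) r, g (z + ξ)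
      ≤ ∫⁻ ξ in Sd (0, fun _ => -π), g (z + ξ) := lintegral_mono_set hsub
    _ = ∫⁻ ξ in Sd (0, fun _ => -π), g (ξ + z) := by simp_rw [add_comm z]
    _ = ∫⁻ ξ, g (ξ + z) ∂(μP d n) := lint_Sd (hg.shift z) _
    _ = _ := lint_shift hg z

instance negPt : (volume : Measure (Pt d n)).IsNegInvariant := by
  have : (volume : Measure (Pt d n)).Regular :=
    Measure.Regular.of_sigmaCompactSpace_of_isLocallyFiniteMeasure _
  exact Measure.IsAddHaarMeasure.isNegInvariant_of_regular (G := Pt d n) (μ := volume)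

theorem ball_lint_neg {g : Pt d n → ENNReal} (hg : Per g) (hm : Measurable g) {r : ℝ} (hr : r ≤ 1)
    (z : Pt d n) :
    ∫⁻ ξ in Metric.closedBall (0 : Pt d n) r, g (z - ξ) ≤ ∫⁻ z, g z ∂(μP d n) := by
  refine le_trans (le_of_eq ?_) (ball_lint hg hr z)
  have h := (Measure.measurePreserving_neg (volume : Measure (Pt d n))).setLIntegral_comp_preimage
    (Metric.isClosed_closedBall (x := (0 : Pt d n)) (ε := r)).measurableSet
    (f := fun ξ => g (z + ξ)) (by fun_prop)
  rw [← h]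
  simp [← sub_eq_add_neg]

theorem weak1 {u : Pt d n → ℂ} (hu : G2 u) {r t V : ℝ} (hr0 : 0 < r) (hr : r ≤ 1) (ht : 0 < t)
    (hV : volume (Metric.closedBall (0 : Pt d n) r) = ENNReal.ofReal V) (hV0 : 0 < V)
    (hM : 3 * (∫ z, ‖u z‖ ^ 2 ∂(μP d n)) ≤ t ^ 2 * V) :
    μP d n {z | t < ‖u z‖} ≤ ENNReal.ofReal (3 / 2 * ((d + n : ℝ) ^ 2 * r ^ 4 * Hs u) / t ^ 2) := by
  set B := Metric.closedBall (0 : Pt d n) r with hB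
  set M := ∫ z, ‖u z‖ ^ 2 ∂(μP d n) with hMdef
  have hM0 : 0 ≤ M := integral_nonneg fun z => by positivity
  have hcu := hu.l0.1
  set g : Pt d n → ENNReal := fun z => ENNReal.ofReal (‖u z‖ ^ 2) with hg
  have hgp : Per g := hu.l0.2.1.comp fun x => ENNReal.ofReal (‖x‖ ^ 2)
  have hgm : Measurable g := by
    have : Measurable u := hcu.measurable
    fun_prop
  have hgM : ∫⁻ z, g z ∂(μP d n) = ENNReal.ofReal M :=
    (ofReal_integral_eq_lintegral_ofReal hu.l0.2.2 (Eventually.of_forall fun z => by positivity)).symm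
  set δ : Pt d n → Pt d n → ENNReal := fun z ξ =>
    ENNReal.ofReal (‖(u (z + ξ) - u z) - (u z - u (z - ξ))‖ ^ 2) with hδ
  have hδm : Measurable (Function.uncurry δ) := by
    have : Continuous (Function.uncurry δ) := by
      simp only [hδ, Function.uncurry_def]
      refine ENNReal.continuous_ofReal.comp ?_
      fun_prop
    exact this.measurable
  set G : Pt d n → ENNReal := fun z => ∫⁻ ξ in B, δ z ξ with hG
  have hGm : Measurable G := hδm.lintegral_prod_right'
  have hpt : ∀ z, t < ‖u z‖ → ENNReal.ofReal (2 * t ^ 2 * V) ≤ 3 * G z := by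
    intro z hz
    have h1 : ∀ ξ, ENNReal.ofReal (4 * t ^ 2) ≤ 3 * (g (z + ξ) + g (z - ξ) + δ z ξ) := by
      intro ξ
      simp only [hg, hδ]
      rw [← ENNReal.ofReal_add (by positivity) (by positivity),
        ← ENNReal.ofReal_add (by positivity) (by positivity),
        show (3 : ENNReal) = ENNReal.ofReal 3 by simp, ← ENNReal.ofReal_mul (by norm_num)]
      refine ENNReal.ofReal_le_ofReal ?_
      set A := u (z + ξ)
      set C := u (z - ξ)
      set F := (A - u z) - (u z - C)
      have e1 : (2:ℂ) * u z = A + C - F := by simp only [F]; ring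
      have e2 : 2 * ‖u z‖ ≤ ‖A‖ + ‖C‖ + ‖F‖ := by
        calc 2 * ‖u z‖ = ‖(2:ℂ) * u z‖ := by simp
          _ = ‖A + C - F‖ := by rw [e1]
          _ ≤ ‖A + C‖ + ‖F‖ := norm_sub_le _ _
          _ ≤ _ := by gcongr; exact norm_add_le _ _
      have e3 : (2 * t) ^ 2 ≤ (‖A‖ + ‖C‖ + ‖F‖) ^ 2 := by
        apply pow_le_pow_left₀ (by positivity)
        linarith
      nlinarith [sq_nonneg (‖A‖ - ‖C‖), sq_nonneg (‖A‖ - ‖F‖), sq_nonneg (‖C‖ - ‖F‖)]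
    have h2 : ENNReal.ofReal (4 * t ^ 2) * ENNReal.ofReal V ≤
        3 * (ENNReal.ofReal M + ENNReal.ofReal M + G z) := by
      calc ENNReal.ofReal (4 * t ^ 2) * ENNReal.ofReal V
          = ∫⁻ ξ in B, ENNReal.ofReal (4 * t ^ 2) := by rw [setLIntegral_const, hV]
        _ ≤ ∫⁻ ξ in B, 3 * (g (z + ξ) + g (z - ξ) + δ z ξ) := lintegral_mono h1
        _ = 3 * ((∫⁻ ξ in B, g (z + ξ)) + (∫⁻ ξ in B, g (z - ξ)) + G z) := by
            rw [lintegral_const_mul' _ _ (by simp), lintegral_add_left (by fun_prop),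
              lintegral_add_left (by fun_prop)]
        _ ≤ _ := by
            have b1 := ball_lint hgp hr z
            have b2 := ball_lint_neg hgp hgm hr z
            rw [hgM] at b1 b2
            exact mul_le_mul_right (add_le_add (add_le_add b1 b2) le_rfl) _
    have h3 : ENNReal.ofReal (2 * t ^ 2 * V) + ENNReal.ofReal (2 * t ^ 2 * V) ≤
        ENNReal.ofReal (2 * t ^ 2 * V) + 3 * G z := by
      calc _ = ENNReal.ofReal (4 * t ^ 2) * ENNReal.ofReal V := by
            rw [← ENNReal.ofReal_add (by positivity) (by positivity),
              ← ENNReal.ofReal_mul (by positivity)]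
            congr 1; ring
        _ ≤ _ := h2
        _ = ENNReal.ofReal (6 * M) + 3 * G z := by
            rw [mul_add, ← ENNReal.ofReal_add hM0 hM0, show (3 : ENNReal) = ENNReal.ofReal 3 by simp,
              ← ENNReal.ofReal_mul (by norm_num)]
            congr 2; ring
        _ ≤ _ := by
            gcongr ENNReal.ofReal ?_ + _
            linarith
    exact (ENNReal.add_le_add_iff_left ENNReal.ofReal_ne_top).1 h3
  set K := (d + n : ℝ) ^ 2 * r ^ 4 * Hs u with hK
  have hK0 : 0 ≤ K := by have := Hs_nonneg u; positivity
  have hint : ∫⁻ z, 3 * G z ∂(μP d n) ≤ ENNReal.ofReal (3 * K * V) := by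
    rw [lintegral_const_mul' _ _ (by simp)]
    simp only [hG]
    rw [lintegral_lintegral_swap hδm.aemeasurable]
    have : ∀ ξ ∈ B, ∫⁻ z, δ z ξ ∂(μP d n) ≤ ENNReal.ofReal K := by
      intro ξ hξ
      rw [hB, mem_closedBall_zero_iff] at hξ
      simp only [hδ]
      rw [← ofReal_integral_eq_lintegral_ofReal (hu.l0.sd ξ).2.2
        (Eventually.of_forall fun z => by positivity)]
      exact ENNReal.ofReal_le_ofReal ((sd_bound hu ξ).trans (DD_bound hu hr0.le hξ))
    calc 3 * ∫⁻ ξ in B, ∫⁻ z, δ z ξ ∂(μP d n) ≤ 3 * ∫⁻ ξ in B, ENNReal.ofReal K := by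
          gcongr 3 * ?_
          exact setLIntegral_mono' Metric.isClosed_closedBall.measurableSet this
      _ = _ := by
          rw [setLIntegral_const, hV, ← ENNReal.ofReal_mul hK0,
            show (3 : ENNReal) = ENNReal.ofReal 3 by simp, ← ENNReal.ofReal_mul (by norm_num)]
          congr 1; ring
  have hch := mul_meas_ge_le_lintegral (μ := μP d n) (hGm.const_mul 3) (ENNReal.ofReal (2 * t ^ 2 * V))
  have hle : ENNReal.ofReal (2 * t ^ 2 * V) * μP d n {z | t < ‖u z‖} ≤ ENNReal.ofReal (3 * K * V) := by
    refine le_trans ?_ (hch.trans hint)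
    refine mul_le_mul_right (measure_mono fun z hz => ?_) _
    exact hpt z hz
  have hpos : 0 < 2 * t ^ 2 * V := by positivity
  have := (ENNReal.le_div_iff_mul_le (a := μP d n {z | t < ‖u z‖}) (b := ENNReal.ofReal (2 * t ^ 2 * V))
    (c := ENNReal.ofReal (3 * K * V)) (Or.inl (by simpa using hpos)) (Or.inl ENNReal.ofReal_ne_top)).2
    (by rwa [mul_comm])
  refine this.trans (le_of_eq ?_)
  rw [← ENNReal.ofReal_div_of_pos hpos]
  congr 1
  field_simp

theorem weak2 (d n : ℕ) (hd : 1 ≤ d) {c : ℝ} (hc : 0 < c) : ∃ t₀ C : ℝ, 0 < t₀ ∧ 0 ≤ C ∧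
    ∀ u : Pt d n → ℂ, G2 u → ∫ z, ‖u z‖ ^ 2 ∂(μP d n) = c → ∀ t, t₀ ≤ t →
      μP d n {z | t < ‖u z‖} ≤ ENNReal.ofReal (C * Hs u * t ^ (-2 - 8 / ((d:ℝ) + n))) := by
  set κ := (volume (Metric.ball (0 : Pt d n) 1)).toReal with hκ
  have hfin : volume (Metric.ball (0 : Pt d n) 1) ≠ ⊤ := measure_ball_lt_top.ne
  have hκ0 : 0 < κ := ENNReal.toReal_pos (Metric.measure_ball_pos _ _ one_pos).ne' hfin
  have hN : (0:ℝ) < (d:ℝ) + n := by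
    have : (1:ℝ) ≤ d := by exact_mod_cast hd
    positivity
  refine ⟨√(3 * c / κ), 3 / 2 * (d + n : ℝ) ^ 2 * (3 * c / κ) ^ (4 / ((d:ℝ) + n)), by positivity,
    by positivity, fun u hu hM t ht => ?_⟩
  have ht0 : 0 < t := lt_of_lt_of_le (by positivity) ht
  have ht2 : 3 * c / κ ≤ t ^ 2 := by
    rw [← Real.sqrt_le_left ht0.le]
    exact ht
  set q := 3 * c / κ / t ^ 2 with hq
  have hq0 : 0 < q := by positivity
  have hq1 : q ≤ 1 := (div_le_one (by positivity)).2 ht2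
  set r := q ^ (1 / ((d:ℝ) + n)) with hr
  have hr0 : 0 < r := by positivity
  have hr1 : r ≤ 1 := Real.rpow_le_one hq0.le hq1 (by positivity)
  have hrN : r ^ (d + n) = q := by
    rw [hr, ← Real.rpow_natCast, ← Real.rpow_mul hq0.le]
    push_cast
    rw [one_div_mul_cancel hN.ne', Real.rpow_one]
  have hV : volume (Metric.closedBall (0 : Pt d n) r) = ENNReal.ofReal (q * κ) := by
    rw [Measure.addHaar_closedBall _ _ hr0.le, Module.finrank_prod, Module.finrank_fin_fun,
      Module.finrank_fin_fun, hrN, ENNReal.ofReal_mul hq0.le, hκ, ENNReal.ofReal_toReal hfin]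
  have h := weak1 hu hr0 hr1 ht0 hV (by positivity) (by
    rw [hM, hq]
    apply le_of_eq
    field_simp)
  refine h.trans (le_of_eq ?_)
  congr 1
  have hr4 : r ^ 4 = (3 * c / κ) ^ (4 / ((d:ℝ) + n)) * t ^ (-(8 / ((d:ℝ) + n))) := by
    rw [hr, ← Real.rpow_natCast, ← Real.rpow_mul hq0.le, hq, Real.div_rpow (by positivity) (by positivity),
      ← Real.rpow_natCast t 2, ← Real.rpow_mul ht0.le, Real.rpow_neg ht0.le, div_eq_mul_inv]
    congr 2
    · push_cast; ring
    · congr 1; push_cast; ring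
  rw [hr4, sub_eq_add_neg, Real.rpow_add ht0, Real.rpow_neg ht0.le 2, Real.rpow_two]
  field_simp

theorem gn (d n : ℕ) (hd : 1 ≤ d) {α c : ℝ} (hα : 0 < α) (hα' : α < 8 / ((d:ℝ) + n)) (hc : 0 < c)
    {ε : ℝ} (hε : 0 < ε) : ∃ C : ℝ, ∀ u : Pt d n → ℂ, G2 u → ∫ z, ‖u z‖ ^ 2 ∂(μP d n) = c →
      Npow d n (α + 2) u ≤ ε * Hs u + C := by
  obtain ⟨t₀, C₀, ht₀, hC₀, hw⟩ := weak2 d n hd hc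
  set b := 8 / ((d:ℝ) + n) - α with hb
  have hb0 : 0 < b := by linarith
  -- choose the cut
  obtain ⟨T, hT0, hTe⟩ : ∃ T, t₀ ≤ T ∧ (α + 2) * C₀ * (T ^ (-b) / b) ≤ ε := by
    have h1 : Tendsto (fun T : ℝ => (α + 2) * C₀ * (T ^ (-b) / b)) atTop (nhds ((α + 2) * C₀ * (0 / b))) :=
      ((tendsto_rpow_neg_atTop hb0).div_const b).const_mul _
    simp only [zero_div, mul_zero] at h1
    obtain ⟨T, h2, h3⟩ := ((eventually_ge_atTop t₀).and (h1.eventually (ge_mem_nhds hε))).exists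
    exact ⟨T, h2, h3⟩
  have hTpos : 0 < T := ht₀.trans_le hT0
  set K₁ := ∫ t in Set.Ioc 0 T, c * t ^ (α - 1) with hK₁
  have hint1 : IntegrableOn (fun t : ℝ => c * t ^ (α - 1)) (Set.Ioc 0 T) := by
    have := intervalIntegral.intervalIntegrable_rpow' (a := 0) (b := T) (r := α - 1) (by linarith)
    rw [intervalIntegrable_iff_integrableOn_Ioc_of_le hTpos.le] at this
    exact this.const_mul c
  have hK₁0 : 0 ≤ K₁ := setIntegral_nonneg measurableSet_Ioc fun t ht => by
    have := ht.1; positivity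
  refine ⟨(α + 2) * K₁, fun u hu hM => ?_⟩
  have hH := Hs_nonneg u
  have hcu := hu.l0.1
  have hcheb : ∀ t, 0 < t → μP d n {z | t < ‖u z‖} ≤ ENNReal.ofReal (c / t ^ 2) := by
    intro t ht
    have hm : Measurable fun z => ENNReal.ofReal (‖u z‖ ^ 2) := by
      have := hcu.measurable
      fun_prop
    have h1 := mul_meas_ge_le_lintegral (μ := μP d n) hm (ENNReal.ofReal (t ^ 2))
    rw [← ofReal_integral_eq_lintegral_ofReal hu.l0.2.2
      (Eventually.of_forall fun z => by positivity), hM] at h1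
    have hpos : 0 < t ^ 2 := by positivity
    rw [ENNReal.ofReal_div_of_pos hpos, ENNReal.le_div_iff_mul_le
      (Or.inl (by simpa using ht.ne')) (Or.inl ENNReal.ofReal_ne_top), mul_comm]
    refine le_trans ?_ h1
    refine mul_le_mul_right (measure_mono fun z hz => ?_) _
    have hz' : t < ‖u z‖ := hz
    exact ENNReal.ofReal_le_ofReal (by gcongr)
  have hlay := lintegral_rpow_eq_lintegral_meas_lt_mul (μP d n) (f := fun z => ‖u z‖)
    (Eventually.of_forall fun z => norm_nonneg _) hcu.norm.measurable.aemeasurable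
    (p := α + 2) (by linarith)
  have hp1 : α + 2 - 1 = α + 1 := by ring
  rw [hp1] at hlay
  have hfirst : ∫⁻ t in Set.Ioc 0 T, μP d n {z | t < ‖u z‖} * ENNReal.ofReal (t ^ (α + 1)) ≤
      ENNReal.ofReal K₁ := by
    rw [hK₁, ofReal_integral_eq_lintegral_ofReal hint1 ((ae_restrict_iff' measurableSet_Ioc).2
      (Eventually.of_forall fun t ht => by have := ht.1; positivity))]
    refine setLIntegral_mono' measurableSet_Ioc fun t ht => ?_
    have ht0 : 0 < t := ht.1
    refine (mul_le_mul_left (hcheb t ht.1) _).trans (le_of_eq ?_)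
    rw [← ENNReal.ofReal_mul (by positivity)]
    congr 1
    rw [show α + 1 = (α - 1) + 2 by ring, Real.rpow_add ht0, Real.rpow_two]
    field_simp
  have hsec : ∫⁻ t in Set.Ioi T, μP d n {z | t < ‖u z‖} * ENNReal.ofReal (t ^ (α + 1)) ≤
      ENNReal.ofReal (C₀ * Hs u * (T ^ (-b) / b)) := by
    have hI := integrableOn_Ioi_rpow_of_lt (a := -b - 1) (by linarith) hTpos
    have hv : C₀ * Hs u * (T ^ (-b) / b) = ∫ t in Set.Ioi T, C₀ * Hs u * t ^ (-b - 1) := by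
      rw [integral_const_mul, integral_Ioi_rpow_of_lt (by linarith) hTpos]
      rw [show -b - 1 + 1 = -b by ring, neg_div_neg_eq]
    rw [hv, ofReal_integral_eq_lintegral_ofReal (hI.const_mul _)
      ((ae_restrict_iff' measurableSet_Ioi).2
      (Eventually.of_forall fun t ht => by
        have : 0 < t := hTpos.trans ht
        positivity))]
    refine setLIntegral_mono' measurableSet_Ioi fun t ht => ?_
    have ht0 : 0 < t := hTpos.trans ht
    refine (mul_le_mul_left (hw u hu hM t (hT0.trans (le_of_lt ht))) _).trans (le_of_eq ?_)
    rw [← ENNReal.ofReal_mul (by positivity), mul_assoc, ← Real.rpow_add ht0]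
    congr 3
    rw [hb]; ring
  have hsplit : ∫⁻ z, ENNReal.ofReal (‖u z‖ ^ (α + 2)) ∂(μP d n) ≤
      ENNReal.ofReal (ε * Hs u + (α + 2) * K₁) := by
    rw [hlay, ← Set.Ioc_union_Ioi_eq_Ioi hTpos.le,
      lintegral_union measurableSet_Ioi Set.Ioc_disjoint_Ioi_same]
    refine (mul_le_mul_right (add_le_add hfirst hsec) _).trans ?_
    rw [← ENNReal.ofReal_add hK₁0 (by positivity), ← ENNReal.ofReal_mul (by linarith)]
    refine ENNReal.ofReal_le_ofReal ?_
    have := mul_le_mul_of_nonneg_right hTe hH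
    linarith
  unfold Npow
  rw [integral_eq_lintegral_of_nonneg_ae (Eventually.of_forall fun z => by positivity)
    (by
      have : Measurable fun z => ‖u z‖ ^ (α + 2) := hcu.norm.measurable.pow_const _
      exact this.aestronglyMeasurable)]
  refine ENNReal.toReal_le_of_le_ofReal (by positivity) hsplit

theorem grad_pt (u : Pt d n → ℂ) (z : Pt d n) :
    (∑ i, ‖dX d n i u z‖^2) + ∑ j, ‖dY d n j u z‖^2 = ∑ a, ‖D (ev a) u z‖ ^ 2 := by
  rw [Fintype.sum_sum_type]; rfl

theorem hess_pt (u : Pt d n → ℂ) (z : Pt d n) :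
    hessInt d n u z = ∑ b, ∑ a, ‖D (ev b) (D (ev a) u) z‖ ^ 2 := by
  rw [Fintype.sum_sum_type]
  simp_rw [Fintype.sum_sum_type]
  rw [Finset.sum_add_distrib, Finset.sum_add_distrib]
  unfold hessInt
  rw [Finset.sum_comm (f := fun i j => ‖dY d n j (dX d n i u) z‖^2),
    Finset.sum_comm (f := fun j i => ‖dX d n i (dY d n j u) z‖^2)]
  have : ∀ A B C E : ℝ, A + B + C + E = A + C + (B + E) := by intros; ring
  rw [this]
  rfl

theorem lap_eq (u : Pt d n → ℂ) : lap d n u = Lap u := by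
  ext z
  unfold Lap
  rw [Fintype.sum_sum_type]; rfl

theorem G2_of {u : Pt d n → ℂ} (h : InH2 d n u) : G2 u := by
  obtain ⟨h1, h2, h3, h4, h5⟩ := h
  have hp : Per u := h2
  have c1 : ContDiff ℝ 1 u := h1.of_le (by norm_num)
  refine ⟨h1, ⟨h1.continuous, hp, h3⟩, fun a => ?_, fun a b => ?_⟩
  · refine ⟨cont_D c1 _, hp.D _, h4.mono' ((cont_D c1 _).norm.pow 2).aestronglyMeasurable
      (Eventually.of_forall fun z => ?_)⟩
    rw [grad_pt, norm_pow, norm_norm]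
    exact Finset.single_le_sum (f := fun a => ‖D (ev a) u z‖ ^ 2) (fun _ _ => by positivity)
      (Finset.mem_univ a)
  · have hcc := cont_D (contDiff_D h1 (ev b)) (ev a)
    refine ⟨hcc, (hp.D _).D _, h5.mono' (hcc.norm.pow 2).aestronglyMeasurable
      (Eventually.of_forall fun z => ?_)⟩
    rw [hess_pt, norm_pow, norm_norm]
    refine le_trans ?_ (Finset.single_le_sum (f := fun a => ∑ b, ‖D (ev a) (D (ev b) u) z‖ ^ 2)
      (fun _ _ => by positivity) (Finset.mem_univ a))
    exact Finset.single_le_sum (f := fun b => ‖D (ev a) (D (ev b) u) z‖ ^ 2)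
      (fun _ _ => by positivity) (Finset.mem_univ b)

theorem hessSq_eq {u : Pt d n → ℂ} (hu : G2 u) : hessSq d n u = Hs u := by
  unfold hessSq Hs
  simp_rw [hess_pt]
  have hI : ∀ b, Integrable (fun z => ∑ a, ‖D (ev b) (D (ev a) u) z‖ ^ 2) (μP d n) := fun b =>
    integrable_finsetSum _ fun a _ => (hu.l2 b a).2.2
  rw [integral_finsetSum _ fun b _ => hI b]
  refine Finset.sum_congr rfl fun b _ => ?_
  rw [integral_finsetSum _ fun a _ => (hu.l2 b a).2.2]

theorem gradSq_eq {u : Pt d n → ℂ} (hu : G2 u) :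
    gradSq d n u = ∑ a, ∫ z, ‖D (ev a) u z‖ ^ 2 ∂(μP d n) := by
  unfold gradSq gradXSq gradYSq
  have h1 := integral_finsetSum (μ := μP d n) (Finset.univ : Finset (Fin d))
    fun i _ => (hu.l1 (Sum.inl i)).2.2
  have h2 := integral_finsetSum (μ := μP d n) (Finset.univ : Finset (Fin n))
    fun j _ => (hu.l1 (Sum.inr j)).2.2
  rw [Fintype.sum_sum_type, ← h1, ← h2]
  rfl

/-- Coercivity of the energy. -/
theorem coercive (d n : ℕ) (hd : 1 ≤ d) (β : ℝ) {α c : ℝ} (hα : 0 < α)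
    (hα' : α < 8 / ((d:ℝ) + n)) (hc : 0 < c) :
    ∃ C : ℝ, ∀ u ∈ Sset d n c, lapSq d n u / 8 - C ≤ En d n β α u := by
  have hN : (0:ℝ) < (d:ℝ) + n := by
    have : (1:ℝ) ≤ d := by exact_mod_cast hd
    positivity
  obtain ⟨C, hC⟩ := gn d n hd hα hα' hc (ε := 1 / (4 * ((d:ℝ) + n))) (by positivity)
  set t := 1 / (2 * (|β| + 1)) with ht
  have ht0 : 0 < t := by positivity
  refine ⟨|β| / 4 * (t⁻¹ * c) + |C|, fun u hu => ?_⟩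
  obtain ⟨hu1, hu2⟩ := hu
  have hg := G2_of hu1
  have hm : ∫ z, ‖u z‖ ^ 2 ∂(μP d n) = c := hu2
  have h1 := hC u hg hm
  have h2 := grad_le hg ht0
  have h3 := hess_le hg
  rw [hm, ← gradSq_eq hg] at h2
  have hl : ∫ z, ‖Lap u z‖ ^ 2 ∂(μP d n) = lapSq d n u := by unfold lapSq; rw [lap_eq]
  rw [hl] at h2 h3
  change Hs u ≤ _ at h3
  have hl0 : 0 ≤ lapSq d n u := integral_nonneg fun z => by positivity
  have hg0 : 0 ≤ gradSq d n u := by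
    rw [gradSq_eq hg]
    exact Finset.sum_nonneg fun a _ => integral_nonneg fun z => by positivity
  have h4 : Npow d n (α + 2) u ≤ lapSq d n u / 4 + |C| := by
    have : 1 / (4 * ((d:ℝ) + n)) * Hs u ≤ lapSq d n u / 4 := by
      calc 1 / (4 * ((d:ℝ) + n)) * Hs u
          ≤ 1 / (4 * ((d:ℝ) + n)) * (((d:ℝ) + n) * lapSq d n u) := by gcongr
        _ = _ := by field_simp
    have := le_abs_self C
    linarith
  have h5 : 1 / (α + 2) * Npow d n (α + 2) u ≤ lapSq d n u / 8 * 2 + |C| := by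
    have hn0 : 0 ≤ Npow d n (α + 2) u := integral_nonneg fun z => by positivity
    have : 1 / (α + 2) ≤ 1 := by
      rw [div_le_one (by linarith)]; linarith
    nlinarith
  have h6 : -(|β| / 2 * gradSq d n u) ≤ β / 2 * gradSq d n u := by
    have := neg_abs_le β
    nlinarith
  have h7 : |β| / 2 * gradSq d n u ≤ lapSq d n u / 8 + |β| / 4 * (t⁻¹ * c) := by
    have h8 : |β| / 2 * gradSq d n u ≤ |β| / 2 * (1/2 * (t * lapSq d n u + t⁻¹ * c)) := by gcongr
    have h9 : |β| * t ≤ 1 / 2 := by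
      rw [ht, mul_one_div, div_le_div_iff₀ (by positivity) (by norm_num)]
      linarith
    have h10 := mul_le_mul_of_nonneg_right h9 hl0
    linarith
  unfold En
  linarith

end Aux3

end BNLS

open BNLS in
/-- `m_c > -∞` and minimizing sequences are bounded in `H²`. -/
theorem stmt_4 (d n : ℕ) (hd : 1 ≤ d) (hn : 1 ≤ n) (β α c : ℝ)
    (hα : 0 < α) (hα' : α < 8 / ((d:ℝ)+n)) (hc : 0 < c) :
    BddBelow (En d n β α '' Sset d n c) ∧
    ∀ u : ℕ → Pt d n → ℂ, (∀ k, u k ∈ Sset d n c) →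
      Tendsto (fun k => En d n β α (u k)) atTop (nhds (mC d n β α c)) →
      ∃ B : ℝ, ∀ k, H2norm d n (u k) ≤ B := by
  obtain ⟨C, hC⟩ := coercive d n hd β hα hα' hc
  refine ⟨⟨-C, ?_⟩, fun u hu ht => ?_⟩
  · rintro _ ⟨u, hu, rfl⟩
    have h1 := hC u hu
    have hl0 : 0 ≤ lapSq d n u := integral_nonneg fun z => by positivity
    linarith
  · obtain ⟨A, hA⟩ := ht.bddAbove_range
    refine ⟨√(c + 1/2 * (1 * (8 * (A + C)) + (1:ℝ)⁻¹ * c) + ((d:ℝ) + n) * (8 * (A + C))),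
      fun k => Real.sqrt_le_sqrt ?_⟩
    have hEA : En d n β α (u k) ≤ A := hA ⟨k, rfl⟩
    have h1 := hC (u k) (hu k)
    have hg := G2_of (hu k).1
    have hm : ∫ z, ‖u k z‖ ^ 2 ∂(μP d n) = c := (hu k).2
    have h2 := grad_le hg one_pos
    have h3 := hess_le hg
    rw [hm, ← gradSq_eq hg] at h2
    have hl : ∫ z, ‖Lap (u k) z‖ ^ 2 ∂(μP d n) = lapSq d n (u k) := by unfold lapSq; rw [lap_eq]
    rw [hl] at h2 h3
    change Hs (u k) ≤ _ at h3
    rw [hessSq_eq hg]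
    have hM : Mass d n (u k) = c := (hu k).2
    have h4 : lapSq d n (u k) ≤ 8 * (A + C) := by linarith
    have h5 : ((d:ℝ) + n) * lapSq d n (u k) ≤ ((d:ℝ) + n) * (8 * (A + C)) := by gcongr
    linarith
end
end
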